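/- Let K be a convex body in ℝ^d, d ≥ 3, and let DK = (1/2)(K + (−K)) be its difference body (Minkowski average of K and its reflection through the origin). Then W_{d-2}(DK) ≥ W_{d-2}(K), with equality if and only if K is centrally symmetric. -/

import Mathlib

open MeasureTheory Metric Filter Topology
open scoped Pointwise ENNReal

noncomputable section

abbrev Ed (d : ℕ) := EuclideanSpace ℝ (Fin d)

def sphereSet (d : ℕ) : Set (Ed d) := Metric.sphere 0 1

/-- The surface measure on the unit sphere `S^{d-1} ⊆ ℝ^d`, realized as the
`(d-1)`-dimensional Hausdorff measure restricted to the sphere. -/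
def sphereMeasure (d : ℕ) : Measure (Ed d) := (μH[(d : ℝ) - 1]).restrict (sphereSet d)

/-- `L²` norm of a function on the sphere `S^{d-1}`. -/
def L2norm (d : ℕ) (f : Ed d → ℝ) : ℝ := Real.sqrt (∫ x, f x ^ 2 ∂ sphereMeasure d)

/-- sup norm of a function on the sphere `S^{d-1}`. -/
def supNorm (d : ℕ) (f : Ed d → ℝ) : ℝ := sSup ((fun x => |f x|) '' sphereSet d)

/-- The set of admissible constants `M` in the definition of the norm `‖f‖_{U_a}`. -/
def UaSet (d : ℕ) (a : ℝ) (f : Ed d → ℝ) : Set ℝ :=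
  {M | 0 < M ∧ BddAbove ((fun x => |f x|) '' sphereSet d) ∧ supNorm d f < M ∧
    ∀ n : ℕ, 0 < n → ∃ p : MvPolynomial (Fin d) ℝ, p.totalDegree ≤ n ∧
      L2norm d (fun x => f x - MvPolynomial.eval (fun i => x i) p) < M * (n : ℝ) ^ (-a)}

/-- Membership in the class `U_a`. -/
def MemUa (d : ℕ) (a : ℝ) (f : Ed d → ℝ) : Prop := (UaSet d a f).Nonempty

/-- The norm `‖f‖_{U_a}`. -/
def UaNorm (d : ℕ) (a : ℝ) (f : Ed d → ℝ) : ℝ := sInf (UaSet d a f)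

/-- The `(d-2)`-dimensional surface measure on the subsphere `S^{d-1} ∩ x^⊥`. -/
def subSphere (d : ℕ) (x : Ed d) : Measure (Ed d) :=
  (μH[(d : ℝ) - 2]).restrict (sphereSet d ∩ {y | (inner ℝ x y : ℝ) = 0})

/-- Iterated integral of a function of `n` variables with respect to a measure `μ`. -/
def iterInt {α : Type*} [MeasurableSpace α] : (n : ℕ) → Measure α → ((Fin n → α) → ℝ) → ℝ
  | 0, _, F => F (fun i => i.elim0)
  | n + 1, μ, F => ∫ t, iterInt n μ (fun v => F (Fin.cons t v)) ∂μ

/-- For `x ∈ S^{d-1}` and `x_1, …, x_{d-1} ∈ x^⊥`, the determinant of `x_1, …, x_{d-1}`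
with respect to an orthonormal basis of `x^⊥` coincides, up to sign, with the `d × d`
determinant of the vectors `x_1, …, x_{d-1}, x`; we use the latter. -/
def detCols (d : ℕ) (v : Fin (d - 1) → Ed d) (x : Ed d) : ℝ :=
  Matrix.det (Matrix.of (fun (i j : Fin d) =>
    if h : (j : ℕ) < d - 1 then v ⟨(j : ℕ), h⟩ i else x i))

def QInt (d : ℕ) (g : Fin (d - 1) → Ed d → ℝ) (x : Ed d) : ℝ :=
  iterInt (d - 1) (subSphere d x) (fun v => detCols d v x ^ 2 * ∏ k, g k (v k))

/-- The normalizing constant `c_d`, chosen so that `Q(1, …, 1) = 1`. -/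
def cQ (d : ℕ) : ℝ :=
  if h : 0 < d then (QInt d (fun _ _ => 1) (EuclideanSpace.single (⟨0, h⟩ : Fin d) 1))⁻¹ else 1

/-- The transform `Q(g_1, …, g_{d-1})`. -/
def Qfun (d : ℕ) (g : Fin (d - 1) → Ed d → ℝ) (x : Ed d) : ℝ := cQ d * QInt d g x

/-- The total surface measure `|S^{n-1}|` of the unit sphere in `ℝ^n`. -/
def sphVol (n : ℕ) : ℝ := (μH[(n : ℝ) - 1] (Metric.sphere (0 : EuclideanSpace ℝ (Fin n)) 1)).toReal

/-- The normalized Radon transform, `R(1) = 1`. -/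
def Radon (d : ℕ) (f : Ed d → ℝ) (x : Ed d) : ℝ :=
  (sphVol (d - 1))⁻¹ * ∫ y, f y ∂ subSphere d x

def IsConvexBody (d : ℕ) (K : Set (Ed d)) : Prop :=
  Convex ℝ K ∧ IsCompact K ∧ (interior K).Nonempty

/-- Support function of a set. -/
def suppFn (d : ℕ) (K : Set (Ed d)) (u : Ed d) : ℝ := sSup ((fun y => (inner ℝ u y : ℝ)) '' K)

/-- Orthogonal projection onto the hyperplane `u^⊥` (for a unit vector `u`). -/
def projHyp (d : ℕ) (u : Ed d) (y : Ed d) : Ed d := y - (inner ℝ y u : ℝ) • u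

/-- `P` is the projection body of `K`: its support function at a unit vector `u` is the
`(d-1)`-volume of the projection of `K` to `u^⊥`. -/
def IsProjBody (d : ℕ) (K P : Set (Ed d)) : Prop :=
  IsConvexBody d P ∧
    ∀ u : Ed d, ‖u‖ = 1 → suppFn d P u = (μH[(d : ℝ) - 1] (projHyp d u '' K)).toReal

/-- `K` has absolutely continuous surface area measure with curvature function `f`:
the surface area measure of every Borel subset `ω` of the sphere (that is, the
`(d-1)`-dimensional Hausdorff measure of the set of boundary points of `K` having an outer
unit normal in `ω`) equals `∫_ω f`. -/
def HasCurvatureFn (d : ℕ) (K : Set (Ed d)) (f : Ed d → ℝ) : Prop :=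
  ∀ ω : Set (Ed d), MeasurableSet ω → ω ⊆ sphereSet d →
    μH[(d : ℝ) - 1] {x | x ∈ frontier K ∧
        ∃ u ∈ ω, ∀ y ∈ K, (inner ℝ u y : ℝ) ≤ (inner ℝ u x : ℝ)} =
      ENNReal.ofReal (∫ y in ω, f y ∂ sphereMeasure d)

/-- Banach–Mazur distance. -/
def bmDist (d : ℕ) (K L : Set (Ed d)) : ℝ :=
  sInf {t : ℝ | 1 ≤ t ∧ ∃ T : Ed d ≃L[ℝ] Ed d, L ⊆ T '' K ∧ T '' K ⊆ t • L}

/-- Action `(Tf)(x) = f(Tx/|Tx|) |Tx|^{-(d+1)}`. -/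
def Tact (d : ℕ) (T : Ed d ≃L[ℝ] Ed d) (f : Ed d → ℝ) (x : Ed d) : ℝ :=
  f ((‖T x‖)⁻¹ • T x) * ‖T x‖ ^ (-((d : ℝ) + 1))

/-- Action `(T̂f)(x) = f(Tx/|Tx|) |Tx|^{-1}`. -/
def hatAct (d : ℕ) (T : Ed d ≃L[ℝ] Ed d) (f : Ed d → ℝ) (x : Ed d) : ℝ :=
  f ((‖T x‖)⁻¹ • T x) * (‖T x‖)⁻¹

/-- `h` is (the restriction to the sphere of) a spherical harmonic of degree `k`:
a harmonic polynomial, homogeneous of degree `k`. -/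
def SphHarm (d k : ℕ) (h : Ed d → ℝ) : Prop :=
  ∃ p : MvPolynomial (Fin d) ℝ, p.IsHomogeneous k ∧
    (∑ i : Fin d, MvPolynomial.pderiv i (MvPolynomial.pderiv i p)) = 0 ∧
    ∀ x ∈ sphereSet d, h x = MvPolynomial.eval (fun i => x i) p

/-- `h` is the degree-`2` spherical harmonic component `H_2^ψ` of `ψ`. -/
def IsDeg2Part (d : ℕ) (ψ h : Ed d → ℝ) : Prop :=
  SphHarm d 2 h ∧ ∀ g : Ed d → ℝ, SphHarm d 2 g →
    ∫ x, (ψ x - h x) * g x ∂ sphereMeasure d = 0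

def unitBall (d : ℕ) : Set (Ed d) := Metric.closedBall 0 1

/-- `W` is the sequence of quermassintegrals of `K`, via the Steiner formula. -/
def IsQuermass (d : ℕ) (K : Set (Ed d)) (W : ℕ → ℝ) : Prop :=
  ∀ t : ℝ, 0 ≤ t → (volume (K + t • unitBall d)).toReal =
    ∑ i ∈ Finset.range (d + 1), (d.choose i : ℝ) * W i * t ^ i

/-- `W` is the sequence of quermassintegrals of `A ⊆ u^⊥` computed within the
`(d-1)`-dimensional space `u^⊥`, via the Steiner formula in `u^⊥`. -/
def IsQuermassHyp (d : ℕ) (u : Ed d) (A : Set (Ed d)) (W : ℕ → ℝ) : Prop :=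
  ∀ t : ℝ, 0 ≤ t →
    (μH[(d : ℝ) - 1] (A + t • (unitBall d ∩ {y | (inner ℝ u y : ℝ) = 0}))).toReal =
      ∑ i ∈ Finset.range d, ((d - 1).choose i : ℝ) * W i * t ^ i

/-- `P` is the `i`-th projection body `Π_i K` of `K`. -/
def IsIthProjBody (d : ℕ) (i : ℕ) (K P : Set (Ed d)) : Prop :=
  IsConvexBody d P ∧ ∀ u : Ed d, ‖u‖ = 1 →
    ∀ W : ℕ → ℝ, IsQuermassHyp d u (projHyp d u '' K) W → suppFn d P u = W i

/-- `ω_n`, the volume of the `n`-dimensional Euclidean unit ball. -/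
def ballVol (n : ℕ) : ℝ := (volume (Metric.closedBall (0 : EuclideanSpace ℝ (Fin n)) 1)).toReal

/-- A set is centrally symmetric if some translate of it equals its reflection in the origin. -/
def IsCentSymm (d : ℕ) (K : Set (Ed d)) : Prop := ∃ v : Ed d, (fun x => x + v) '' K = -K



section Wirtinger
open intervalIntegral Set

lemma lip_deriv_sq_int {ψ : ℝ → ℝ} {C : NNReal} (h : LipschitzWith C ψ) (a b : ℝ) :
    IntervalIntegrable (fun x => deriv ψ x ^ 2) volume a b := by
  refine (intervalIntegrable_const (c := (C:ℝ)^2) (μ := volume) (a := a) (b := b)).mono_fun ?_ ?_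
  · exact ((measurable_deriv ψ).pow_const 2).aestronglyMeasurable
  · refine Eventually.of_forall fun x => ?_
    have := norm_deriv_le_of_lipschitz h (x₀ := x)
    simp only [norm_pow, NNReal.norm_eq]
    gcongr

lemma cot_ident {ψ : ℝ → ℝ} {C : NNReal} (h : LipschitzWith C ψ) {a b : ℝ} (ha : 0 < a)
    (hab : a ≤ b) (hb : b < Real.pi) :
    ∫ x in a..b, (deriv ψ x - ψ x * (Real.cos x / Real.sin x)) ^ 2 =
      (∫ x in a..b, (deriv ψ x ^ 2 - ψ x ^ 2)) -
        (ψ b ^ 2 * (Real.cos b / Real.sin b) - ψ a ^ 2 * (Real.cos a / Real.sin a)) := by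
  have hsin : ∀ x ∈ uIcc a b, 0 < Real.sin x := by
    intro x hx
    rw [uIcc_of_le hab] at hx
    exact Real.sin_pos_of_pos_of_lt_pi (by linarith [hx.1]) (by linarith [hx.2])
  have hac : AbsolutelyContinuousOnInterval ψ a b := h.lipschitzOnWith.absolutelyContinuousOnInterval
  have hac2 : AbsolutelyContinuousOnInterval (ψ * ψ) a b := hac.mul hac
  have hcot : AbsolutelyContinuousOnInterval (fun x => Real.cos x / Real.sin x) a b := by
    apply ContDiffOn.absolutelyContinuousOnInterval
    exact Real.contDiff_cos.contDiffOn.div Real.contDiff_sin.contDiffOn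
      (fun x hx => (hsin x hx).ne')
  have key := hac2.integral_deriv_mul_eq_sub hcot
  have hcont : ContinuousOn (fun x => Real.cos x / Real.sin x) (uIcc a b) := hcot.continuousOn
  have i1 : IntervalIntegrable (fun x => deriv ψ x ^ 2 - ψ x ^ 2) volume a b :=
    (lip_deriv_sq_int h a b).sub ((h.continuous.pow 2).intervalIntegrable a b)
  have i2 : IntervalIntegrable (fun x => deriv (ψ * ψ) x * (Real.cos x / Real.sin x)
      + (ψ * ψ) x * deriv (fun x => Real.cos x / Real.sin x) x) volume a b :=
    (hac2.intervalIntegrable_deriv.mul_continuousOn hcot.continuousOn).add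
      (hcot.intervalIntegrable_deriv.continuousOn_mul hac2.continuousOn)
  simp only [Pi.mul_apply] at key i2
  rw [show ψ b ^ 2 * (Real.cos b / Real.sin b) - ψ a ^ 2 * (Real.cos a / Real.sin a) =
    ψ b * ψ b * (Real.cos b / Real.sin b) - ψ a * ψ a * (Real.cos a / Real.sin a) by ring, ← key,
    ← integral_sub i1 i2]
  apply intervalIntegral.integral_congr_ae
  filter_upwards [hac.ae_differentiableAt] with x hx hxm
  have hx' := uIoc_subset_uIcc hxm
  have hd := (hx hx').hasDerivAt
  have e1 : deriv (ψ * ψ) x = deriv ψ x * ψ x + ψ x * deriv ψ x := (hd.mul hd).deriv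
  have hs := hsin x hx'
  have e2 : deriv (fun x => Real.cos x / Real.sin x) x =
      ((-Real.sin x) * Real.sin x - Real.cos x * Real.cos x) / Real.sin x ^ 2 :=
    ((Real.hasDerivAt_cos x).div (Real.hasDerivAt_sin x) hs.ne').deriv
  rw [e1, e2]
  have := Real.sin_sq_add_cos_sq x
  field_simp
  linear_combination (ψ x)^2 * (1 - 1) * this

lemma wirt0 {ψ : ℝ → ℝ} {C : NNReal} (h : LipschitzWith C ψ) (h0 : ψ 0 = 0) (h1 : ψ Real.pi = 0) :
    0 ≤ ∫ x in (0:ℝ)..Real.pi, (deriv ψ x ^ 2 - ψ x ^ 2) ∧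
    ((∫ x in (0:ℝ)..Real.pi, (deriv ψ x ^ 2 - ψ x ^ 2)) = 0 →
      ∀ x ∈ Icc 0 Real.pi, ψ x = ψ (Real.pi / 2) * Real.sin x) := by
  have hpi := Real.pi_pos
  set D := ∫ x in (0:ℝ)..Real.pi, (deriv ψ x ^ 2 - ψ x ^ 2) with hD
  let En : ℝ → ℝ := fun e => ∫ x in e..(Real.pi - e), (deriv ψ x - ψ x * (Real.cos x / Real.sin x)) ^ 2
  have hintg : ∀ a b, IntervalIntegrable (fun x => deriv ψ x ^ 2 - ψ x ^ 2) volume a b := fun a b =>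
    (lip_deriv_sq_int h a b).sub ((h.continuous.pow 2).intervalIntegrable a b)
  have bnd : ∀ a b, |ψ a - ψ b| ≤ C * |a - b| := by
    intro a b
    have := h.dist_le_mul a b
    simpa [Real.dist_eq] using this
  have hlim : Tendsto En (𝓝[>] 0) (𝓝 D) := by
    have hev : ∀ᶠ e in 𝓝[>] (0:ℝ), En e = (∫ x in e..(Real.pi - e), (deriv ψ x ^ 2 - ψ x ^ 2)) +
       (ψ (Real.pi - e) ^ 2 * (Real.cos e / Real.sin e) + ψ e ^ 2 * (Real.cos e / Real.sin e)) := by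
      have : Ioo (0:ℝ) (Real.pi/2) ∈ 𝓝[>] (0:ℝ) := Ioo_mem_nhdsGT (by positivity)
      filter_upwards [this] with e he
      simp only [En]
      rw [cot_ident h he.1 (by linarith [he.2]) (by linarith [he.1])]
      rw [Real.cos_pi_sub, Real.sin_pi_sub]; ring
    refine Tendsto.congr' (hev.mono fun e he => he.symm) ?_
    have t1 : Tendsto (fun e => ∫ x in e..(Real.pi - e), (deriv ψ x ^ 2 - ψ x ^ 2)) (𝓝[>] 0) (𝓝 D) := by
      have hc : Continuous (fun b => ∫ x in (0:ℝ)..b, (deriv ψ x ^ 2 - ψ x ^ 2)) :=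
        continuous_primitive hintg 0
      have : (fun e => ∫ x in e..(Real.pi - e), (deriv ψ x ^ 2 - ψ x ^ 2)) =
        fun e => (∫ x in (0:ℝ)..(Real.pi - e), (deriv ψ x ^ 2 - ψ x ^ 2)) -
          ∫ x in (0:ℝ)..e, (deriv ψ x ^ 2 - ψ x ^ 2) := by
        funext e
        rw [integral_interval_sub_left (hintg _ _) (hintg _ _)]
      rw [this]
      have hc2 : Continuous (fun e => (∫ x in (0:ℝ)..(Real.pi - e), (deriv ψ x ^ 2 - ψ x ^ 2)) -
          ∫ x in (0:ℝ)..e, (deriv ψ x ^ 2 - ψ x ^ 2)) :=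
        (hc.comp (continuous_const.sub continuous_id)).sub hc
      have := hc2.tendsto 0
      simp only [sub_zero, integral_same] at this
      exact this.mono_left nhdsWithin_le_nhds
    have t2 : Tendsto (fun e => (ψ (Real.pi - e) ^ 2 * (Real.cos e / Real.sin e) +
        ψ e ^ 2 * (Real.cos e / Real.sin e))) (𝓝[>] 0) (𝓝 0) := by
      have hub : Tendsto (fun e : ℝ => 2 * ((C:ℝ)^2 * (e * (Real.pi / 2)))) (𝓝[>] 0) (𝓝 0) := by
        have : Continuous (fun e : ℝ => 2 * ((C:ℝ)^2 * (e * (Real.pi / 2)))) := by fun_prop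
        have := this.tendsto 0
        simp only [zero_mul, mul_zero] at this
        exact this.mono_left nhdsWithin_le_nhds
      refine tendsto_of_tendsto_of_tendsto_of_le_of_le' tendsto_const_nhds hub ?_ ?_
      · filter_upwards [Ioo_mem_nhdsGT (show (0:ℝ) < Real.pi/2 by positivity)] with e he
        have := Real.sin_pos_of_pos_of_lt_pi he.1 (by linarith [he.2])
        have := Real.cos_pos_of_mem_Ioo ⟨by linarith [he.1], he.2⟩
        positivity
      · filter_upwards [Ioo_mem_nhdsGT (show (0:ℝ) < Real.pi/2 by positivity)] with e he
        have hs := Real.sin_pos_of_pos_of_lt_pi he.1 (by linarith [he.2])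
        have hcp := Real.cos_pos_of_mem_Ioo ⟨by linarith [he.1], he.2⟩
        have hj : 2 / Real.pi * e ≤ Real.sin e := Real.mul_le_sin he.1.le he.2.le
        have he0 := he.1
        have hcot : Real.cos e / Real.sin e ≤ Real.pi / (2 * e) := by
          rw [div_le_div_iff₀ hs (by positivity)]
          have : Real.cos e ≤ 1 := Real.cos_le_one e
          have h3 : 2 * e ≤ Real.pi * Real.sin e := by
            calc 2 * e = Real.pi * (2 / Real.pi * e) := by field_simp
              _ ≤ _ := by gcongr
          nlinarith
        have b1 : ψ e ^ 2 ≤ (C * e)^2 := by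
          have := bnd e 0
          rw [h0, sub_zero, sub_zero, abs_of_pos he0] at this
          rw [← sq_abs (ψ e)]
          gcongr
        have b2 : ψ (Real.pi - e) ^ 2 ≤ (C * e)^2 := by
          have := bnd (Real.pi - e) Real.pi
          rw [h1, sub_zero, show Real.pi - e - Real.pi = -e by ring, abs_neg, abs_of_pos he0] at this
          rw [← sq_abs (ψ (Real.pi - e))]
          gcongr
        have hcp' : 0 ≤ Real.cos e / Real.sin e := by positivity
        calc _ ≤ (C * e)^2 * (Real.pi / (2*e)) + (C * e)^2 * (Real.pi / (2*e)) := by gcongr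
          _ = _ := by field_simp; ring
    simpa using t1.add t2
  have intg : ∀ a b, 0 < a → a ≤ b → b < Real.pi → IntervalIntegrable
      (fun x => (deriv ψ x - ψ x * (Real.cos x / Real.sin x)) ^ 2) volume a b := by
    intro a b ha hab hb
    have hc : ContinuousOn (fun x => ψ x * (Real.cos x / Real.sin x)) (uIcc a b) := by
      apply h.continuous.continuousOn.mul
      apply Real.continuous_cos.continuousOn.div Real.continuous_sin.continuousOn
      intro x hx
      rw [uIcc_of_le hab] at hx
      exact (Real.sin_pos_of_pos_of_lt_pi (by linarith [hx.1]) (by linarith [hx.2])).ne'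
    have i1 : IntervalIntegrable (deriv ψ) volume a b :=
      (h.lipschitzOnWith.absolutelyContinuousOnInterval).intervalIntegrable_deriv
    have := ((lip_deriv_sq_int h a b).sub ((i1.mul_continuousOn hc).const_mul 2)).add
      ((hc.pow 2).intervalIntegrable)
    refine this.congr ?_
    intro x _
    simp only [Pi.pow_apply]; ring
  have hmono : ∀ e e', 0 < e' → e' ≤ e → e < Real.pi/2 → En e ≤ En e' := by
    intro e e' he' hee he
    apply integral_mono_interval hee (by linarith) (by linarith)
    · exact Eventually.of_forall fun x => by positivity
    · exact intg _ _ he' (by linarith) (by linarith)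
  have hle : ∀ e, 0 < e → e < Real.pi/2 → En e ≤ D := by
    intro e he he2
    apply ge_of_tendsto hlim
    filter_upwards [Ioo_mem_nhdsGT he] with e' he'
    exact hmono e e' he'.1 he'.2.le he2
  have hpos : ∀ e, 0 < e → e < Real.pi/2 → 0 ≤ En e := by
    intro e he he2
    exact integral_nonneg (by linarith) (fun x _ => by positivity)
  refine ⟨(hpos (Real.pi/4) (by positivity) (by linarith)).trans
    (hle (Real.pi/4) (by positivity) (by linarith)), ?_⟩
  intro hD0
  have main : ∀ e, 0 < e → e < Real.pi/2 → ψ e = ψ (Real.pi / 2) * Real.sin e ∧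
      ψ (Real.pi - e) = ψ (Real.pi / 2) * Real.sin (Real.pi - e) := by
    intro e he he2
    have hab : e ≤ Real.pi - e := by linarith
    have hE : En e = 0 := le_antisymm (by rw [← hD0]; exact hle e he he2) (hpos e he he2)
    have hae := (integral_eq_zero_iff_of_le_of_nonneg_ae hab
      (Eventually.of_forall fun x => by positivity) (intg e (Real.pi - e) he hab (by linarith))).1 hE
    rw [Filter.EventuallyEq, ae_restrict_iff' measurableSet_Ioc] at hae
    have hsin : ∀ x ∈ uIcc e (Real.pi - e), 0 < Real.sin x := by
      intro x hx
      rw [uIcc_of_le hab] at hx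
      exact Real.sin_pos_of_pos_of_lt_pi (by linarith [hx.1]) (by linarith [hx.2])
    have hac : AbsolutelyContinuousOnInterval ψ e (Real.pi - e) :=
      h.lipschitzOnWith.absolutelyContinuousOnInterval
    have hinv : AbsolutelyContinuousOnInterval (fun x => (Real.sin x)⁻¹) e (Real.pi - e) := by
      apply ContDiffOn.absolutelyContinuousOnInterval
      exact Real.contDiff_sin.contDiffOn.inv (fun x hx => (hsin x hx).ne')
    have hq := hac.mul hinv
    obtain ⟨c, hc⟩ := hq.const_of_ae_hasDerivAt_zero (by
      have hne : ∀ᵐ x : ℝ, x ≠ e := by simp [ae_iff]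
      filter_upwards [hac.ae_differentiableAt, hae, hne] with x hx1 hx2 hx3 hxm
      have hs := hsin x hxm
      have hx4 : x ∈ Ioc e (Real.pi - e) := by
        rw [uIcc_of_le hab] at hxm
        exact ⟨lt_of_le_of_ne hxm.1 (Ne.symm hx3), hxm.2⟩
      have e1 := hx2 hx4
      simp only [Pi.zero_apply, pow_eq_zero_iff, ne_eq, OfNat.ofNat_ne_zero, not_false_eq_true] at e1
      have e2 : deriv ψ x = ψ x * (Real.cos x / Real.sin x) := by linarith
      have hd := (hx1 hxm).hasDerivAt.mul ((Real.hasDerivAt_sin x).inv hs.ne')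
      have hz : deriv ψ x * Real.sin⁻¹ x + ψ x * (-Real.cos x / Real.sin x ^ 2) = 0 := by
        rw [e2]; simp only [Pi.inv_apply]; field_simp; ring
      rw [hz] at hd
      exact hd)
    have c1 := hc (Real.pi/2) (by rw [uIcc_of_le hab]; constructor <;> linarith)
    have c2 := hc e (by simp)
    have c3 := hc (Real.pi - e) (by simp)
    have s2 := hsin e (by simp)
    have s3 := hsin (Real.pi - e) (by simp)
    simp only [Pi.mul_apply, Real.sin_pi_div_two, inv_one, mul_one] at c1 c2 c3
    rw [c1]
    constructor
    · rw [← c2]; field_simp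
    · rw [← c3]; field_simp
  intro x hx
  rcases eq_or_lt_of_le hx.1 with h2 | h2
  · rw [← h2]; simp [h0]
  rcases eq_or_lt_of_le hx.2 with h3 | h3
  · rw [h3]; simp [h1]
  rcases lt_trichotomy x (Real.pi/2) with h4 | h4 | h4
  · exact (main x h2 h4).1
  · rw [h4]; simp
  · have := (main (Real.pi - x) (by linarith) (by linarith)).2
    simpa using this

lemma wirtinger {φ : ℝ → ℝ} {C : NNReal} (h : LipschitzWith C φ)
    (hap : ∀ t, φ (t + Real.pi) = - φ t) :
    0 ≤ ∫ x in (0:ℝ)..Real.pi, (deriv φ x ^ 2 - φ x ^ 2) ∧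
    ((∫ x in (0:ℝ)..Real.pi, (deriv φ x ^ 2 - φ x ^ 2)) = 0 →
      ∀ x, φ x = φ 0 * Real.cos x + φ (Real.pi / 2) * Real.sin x) := by
  have hpi := Real.pi_pos
  obtain ⟨t0, ht0⟩ : ∃ t, φ t = 0 := by
    have e : φ Real.pi = - φ 0 := by simpa using hap 0
    have := intermediate_value_uIcc (h.continuous.continuousOn (s := uIcc 0 Real.pi))
    have h0 : (0:ℝ) ∈ uIcc (φ 0) (φ Real.pi) := by
      rw [e, mem_uIcc]
      rcases le_total (φ 0) 0 with h | h
      · left; constructor <;> linarith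
      · right; constructor <;> linarith
    obtain ⟨t, _, ht⟩ := this h0
    exact ⟨t, ht⟩
  let ψ : ℝ → ℝ := fun t => φ (t + t0)
  have hψ : LipschitzWith C ψ := by
    have := h.comp (LipschitzWith.id.add (LipschitzWith.const t0))
    simpa [ψ, Function.comp_def] using this
  have hd : ∀ t, deriv ψ t = deriv φ (t + t0) := fun t => deriv_comp_add_const φ t0 t
  have hap' : ∀ t, deriv φ (t + Real.pi) = - deriv φ t := by
    intro t
    rw [← deriv_comp_add_const φ Real.pi t]
    have : (fun x => φ (x + Real.pi)) = fun x => - φ x := funext hap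
    rw [this, deriv.fun_neg]
  have hper : Function.Periodic (fun x => deriv φ x ^ 2 - φ x ^ 2) Real.pi := by
    intro t
    simp only [hap, hap']; ring
  have heq : ∫ x in (0:ℝ)..Real.pi, (deriv φ x ^ 2 - φ x ^ 2) =
      ∫ x in (0:ℝ)..Real.pi, (deriv ψ x ^ 2 - ψ x ^ 2) := by
    have := hper.intervalIntegral_add_eq 0 t0
    rw [zero_add] at this
    rw [this]
    simp only [hd, ψ]
    rw [intervalIntegral.integral_comp_add_right (fun x => deriv φ x ^ 2 - φ x ^ 2) t0, zero_add, add_comm]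
  obtain ⟨w1, w2⟩ := wirt0 hψ (by simp [ψ, ht0]) (by simp only [ψ]; rw [add_comm, hap, ht0, neg_zero])
  rw [heq]
  refine ⟨w1, fun h0 => ?_⟩
  have w3 := w2 h0
  set c := ψ (Real.pi / 2)
  have hall : ∀ t, ψ t = c * Real.sin t := by
    intro t
    have hp : Function.Periodic (fun t => |ψ t - c * Real.sin t|) Real.pi := by
      intro s
      simp only [ψ]
      rw [show s + Real.pi + t0 = s + t0 + Real.pi by ring, hap, Real.sin_add_pi, ← abs_neg]
      congr 1; ring
    obtain ⟨y, hy, hy2⟩ := hp.exists_mem_Ico₀ hpi t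
    have := w3 y ⟨hy.1, hy.2.le⟩
    rw [this, sub_self, abs_zero] at hy2
    linarith [abs_eq_zero.1 hy2]
  have hφ : ∀ x, φ x = c * Real.sin (x - t0) := by
    intro x
    rw [← hall]; simp [ψ]
  intro x
  rw [hφ x, hφ 0, hφ (Real.pi/2)]
  simp only [Real.sin_sub, Real.sin_zero, Real.cos_zero, Real.sin_pi_div_two, Real.cos_pi_div_two]
  ring

end Wirtinger

section GaussianFacts
open ProbabilityTheory GaussianFourier

abbrev gam (d : ℕ) : Measure (Ed d) := stdGaussian (Ed d)

def gconst (d : ℕ) : ℝ := (∫ x : Ed d, Real.exp (-(1/2) * ‖x‖ ^ 2))⁻¹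

lemma gexp_integrable (d : ℕ) : Integrable (fun x : Ed d => Real.exp (-(1/2) * ‖x‖ ^ 2)) := by
  have := (integrable_cexp_neg_mul_sq_norm_add (V := Ed d) (b := (1/2 : ℂ)) (by norm_num) 0 0).norm
  refine this.congr (Eventually.of_forall fun x => ?_)
  simp only [zero_mul, add_zero]
  rw [Complex.norm_exp]
  congr 1
  rw [show (-(1/2:ℂ) * (‖x‖:ℂ)^2) = ((-(1/2) * ‖x‖^2 : ℝ) : ℂ) by push_cast; ring, Complex.ofReal_re]

lemma gint_pos (d : ℕ) : 0 < ∫ x : Ed d, Real.exp (-(1/2) * ‖x‖ ^ 2) := by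
  rw [integral_rexp_neg_mul_sq_norm (by norm_num)]
  have := Real.pi_pos
  positivity

lemma gconst_pos (d : ℕ) : 0 < gconst d := inv_pos.2 (gint_pos d)

lemma gam_eq (d : ℕ) : gam d = (volume : Measure (Ed d)).withDensity
    (fun x => ENNReal.ofReal (gconst d * Real.exp (-(1/2) * ‖x‖ ^ 2))) := by
  have hfin : IsFiniteMeasure ((volume : Measure (Ed d)).withDensity
    (fun x => ENNReal.ofReal (gconst d * Real.exp (-(1/2) * ‖x‖ ^ 2)))) :=
    isFiniteMeasure_withDensity_ofReal ((gexp_integrable d).const_mul _).2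
  refine Measure.ext_of_charFun (funext fun t => ?_)
  rw [charFun_stdGaussian, charFun_apply,
    integral_withDensity_eq_integral_toReal_smul (by fun_prop) (by simp)]
  have hc := gconst_pos d
  have key := fun w : Ed d =>
    integral_cexp_neg_mul_sq_norm_add (V := Ed d) (b := (1/2 : ℂ)) (by norm_num) Complex.I w
  have h0 := key 0
  simp only [inner_zero_left, Complex.ofReal_zero, mul_zero, add_zero, norm_zero, ne_eq,
    OfNat.ofNat_ne_zero, not_false_eq_true, zero_pow, zero_div, Complex.exp_zero, mul_one] at h0
  have h1 : (∫ v : Ed d, Complex.exp (-(1/2) * (‖v‖:ℂ)^2)) =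
      ((∫ x : Ed d, Real.exp (-(1/2) * ‖x‖ ^ 2) : ℝ) : ℂ) := by
    rw [← integral_complex_ofReal]
    congr 1; funext v; push_cast; rfl
  have h2 : ∀ x : Ed d, ((ENNReal.ofReal (gconst d * Real.exp (-(1/2) * ‖x‖ ^ 2))).toReal •
      Complex.exp ((inner ℝ x t : ℝ) * Complex.I)) = (gconst d : ℂ) *
        Complex.exp (-(1/2) * (‖x‖:ℂ)^2 + Complex.I * (inner ℝ t x : ℝ)) := by
    intro x
    rw [ENNReal.toReal_ofReal (by positivity), Complex.real_smul, Complex.exp_add]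
    push_cast
    rw [real_inner_comm, mul_comm Complex.I]
    ring
  simp_rw [h2]
  rw [integral_const_mul, key t, ← h0, h1, gconst]
  push_cast
  rw [inv_mul_cancel_left₀ (by exact_mod_cast (gint_pos d).ne')]
  congr 1
  rw [Complex.I_sq]; ring

lemma gam_integral (d : ℕ) (g : Ed d → ℝ) :
    ∫ x, g x ∂gam d = gconst d * ∫ x, Real.exp (-(1/2) * ‖x‖ ^ 2) * g x := by
  have hc := gconst_pos d
  rw [gam_eq, integral_withDensity_eq_integral_toReal_smul (by fun_prop) (by simp),
    ← integral_const_mul]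
  congr 1; funext x
  rw [ENNReal.toReal_ofReal (by positivity), smul_eq_mul]; ring

lemma gam_ac (d : ℕ) : gam d ≪ volume := by
  rw [gam_eq]; exact withDensity_absolutelyContinuous _ _

instance gam_openPos (d : ℕ) : (gam d).IsOpenPosMeasure := by
  have h : (volume : Measure (Ed d)) ≪ gam d := by
    rw [gam_eq]
    refine withDensity_absolutelyContinuous' (by fun_prop) (Eventually.of_forall fun x => ?_)
    have hc := gconst_pos d
    simp only [ne_eq, ENNReal.ofReal_eq_zero, not_le]
    positivity
  exact h.isOpenPosMeasure

lemma gam_sq (d : ℕ) (L : Ed d →L[ℝ] ℝ) : ∫ y, (L y) ^ 2 ∂gam d = ‖L‖ ^ 2 := by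
  rw [← variance_dual_stdGaussian L, variance_eq_integral (by fun_prop),
    integral_strongDual_stdGaussian]
  simp

lemma gam_neg (d : ℕ) : MeasurePreserving (fun x : Ed d => -x) (gam d) (gam d) := by
  refine ⟨by fun_prop, ?_⟩
  exact stdGaussian_map (LinearIsometryEquiv.neg ℝ : Ed d ≃ₗᵢ[ℝ] Ed d)

lemma gam_rot (d : ℕ) (θ : ℝ) : MeasurePreserving
    (fun p : Ed d × Ed d => (Real.cos θ • p.1 + Real.sin θ • p.2,
      -Real.sin θ • p.1 + Real.cos θ • p.2)) ((gam d).prod (gam d)) ((gam d).prod (gam d)) := by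
  refine ⟨by fun_prop, ?_⟩
  exact IsGaussian.map_rotation_eq_self_of_forall_strongDual_eq_zero
    integral_strongDual_stdGaussian θ

lemma gam_exp (d : ℕ) (R : ℝ) : Integrable (fun x : Ed d => Real.exp (R * ‖x‖)) (gam d) := by
  obtain ⟨C, hC, hi⟩ := IsGaussian.exists_integrable_exp_sq (gam d)
  refine (hi.const_mul (Real.exp (R^2 / (4*C)))).mono' (by fun_prop) (Eventually.of_forall fun x => ?_)
  rw [Real.norm_eq_abs, Real.abs_exp, ← Real.exp_add]
  apply Real.exp_le_exp.2
  have : R^2/(4*C) + C*‖x‖^2 - R*‖x‖ = C * (‖x‖ - R/(2*C))^2 := by field_simp; ring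
  have : 0 ≤ C * (‖x‖ - R/(2*C))^2 := by positivity
  linarith

end GaussianFacts

section Poincare
open ProbabilityTheory

lemma normsq_int (d : ℕ) : Integrable (fun x : Ed d => ‖x‖ ^ 2) (gam d) := by
  have := (IsGaussian.memLp_id (gam d) 2 (by simp)).integrable_norm_pow (by simp)
  simpa using this

lemma lip_fderiv_norm {d : ℕ} {f : Ed d → ℝ} {C : NNReal} (hf : LipschitzWith C f) (x : Ed d) :
    ‖fderiv ℝ f x‖ ≤ C := norm_fderiv_le_of_lipschitz ℝ hf

lemma lip_sq_int {d : ℕ} {f : Ed d → ℝ} {C : NNReal} (hf : LipschitzWith C f) (h0 : f 0 = 0) :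
    Integrable (fun x => f x ^ 2) (gam d) := by
  refine ((normsq_int d).const_mul ((C:ℝ)^2)).mono' (hf.continuous.pow 2).aestronglyMeasurable
    (Eventually.of_forall fun x => ?_)
  have := hf.dist_le_mul x 0
  rw [h0, dist_zero_right, dist_zero_right] at this
  rw [norm_pow, ← mul_pow]
  gcongr

lemma lip_fderiv_sq_int {d : ℕ} {f : Ed d → ℝ} {C : NNReal} (hf : LipschitzWith C f) :
    Integrable (fun x => ‖fderiv ℝ f x‖ ^ 2) (gam d) := by
  refine (integrable_const ((C:ℝ)^2)).mono'
    ((measurable_fderiv ℝ f).norm.pow_const 2).aestronglyMeasurable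
    (Eventually.of_forall fun x => ?_)
  rw [norm_pow, norm_norm]
  gcongr
  exact lip_fderiv_norm hf x

lemma poincare {d : ℕ} {f : Ed d → ℝ} {C : NNReal} (hf : LipschitzWith C f)
    (hodd : ∀ x, f (-x) = - f x) :
    0 ≤ ∫ x, (‖fderiv ℝ f x‖ ^ 2 - f x ^ 2) ∂gam d ∧
    ((∫ x, (‖fderiv ℝ f x‖ ^ 2 - f x ^ 2) ∂gam d) = 0 → ∀ x y : Ed d, ∀ θ : ℝ,
      f (Real.cos θ • x + Real.sin θ • y) = f x * Real.cos θ + f y * Real.sin θ) := by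
  have h0 : f 0 = 0 := by have := hodd 0; rw [neg_zero] at this; linarith
  have hpi := Real.pi_pos
  set P := (gam d).prod (gam d) with hP
  set T : Measure ℝ := volume.restrict (Set.Ioc 0 Real.pi) with hT
  let X : ℝ → Ed d × Ed d → Ed d := fun θ p => Real.cos θ • p.1 + Real.sin θ • p.2
  let Y : ℝ → Ed d × Ed d → Ed d := fun θ p => -Real.sin θ • p.1 + Real.cos θ • p.2
  let g : Ed d × Ed d → ℝ := fun q => (fderiv ℝ f q.1 q.2) ^ 2 - f q.1 ^ 2
  have hgm : Measurable g := by
    have h1 : Measurable (fun q : Ed d × Ed d => (fderiv ℝ f q.1, q.2)) :=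
      ((measurable_fderiv ℝ f).comp measurable_fst).prodMk measurable_snd
    have h2 : Continuous (fun q : (Ed d →L[ℝ] ℝ) × Ed d => q.1 q.2) := by fun_prop
    exact ((h2.measurable.comp h1).pow_const 2).sub
      ((hf.continuous.measurable.comp measurable_fst).pow_const 2)
  have hgb : ∀ q, |g q| ≤ (C:ℝ)^2 * (‖q.1‖^2 + ‖q.2‖^2) := by
    intro q
    have a1 : |fderiv ℝ f q.1 q.2| ≤ C * ‖q.2‖ :=
      ((fderiv ℝ f q.1).le_opNorm q.2).trans (by gcongr; exact lip_fderiv_norm hf _)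
    have a2 : |f q.1| ≤ C * ‖q.1‖ := by
      have := hf.dist_le_mul q.1 0
      rwa [h0, dist_zero_right, dist_zero_right] at this
    have a3 : (fderiv ℝ f q.1 q.2)^2 ≤ (C * ‖q.2‖)^2 := sq_le_sq' (abs_le.1 a1).1 (abs_le.1 a1).2
    have a4 : (f q.1)^2 ≤ (C * ‖q.1‖)^2 := sq_le_sq' (abs_le.1 a2).1 (abs_le.1 a2).2
    simp only [g]
    rw [abs_le]
    constructor <;> nlinarith [sq_nonneg (fderiv ℝ f q.1 q.2), sq_nonneg (f q.1)]
  have hbi : Integrable (fun q : Ed d × Ed d => (C:ℝ)^2 * (‖q.1‖^2 + ‖q.2‖^2)) P :=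
    (((normsq_int d).comp_fst _).add ((normsq_int d).comp_snd _)).const_mul _
  have hgi : Integrable g P := hbi.mono' hgm.aestronglyMeasurable (Eventually.of_forall hgb)
  have hintg : ∫ q, g q ∂P = ∫ x, (‖fderiv ℝ f x‖ ^ 2 - f x ^ 2) ∂gam d := by
    rw [hP, integral_prod _ hgi]
    congr 1; funext x
    have i1 : Integrable (fun y => (fderiv ℝ f x y)^2) (gam d) := by
      refine ((normsq_int d).const_mul (‖fderiv ℝ f x‖^2)).mono' (by fun_prop)
        (Eventually.of_forall fun y => ?_)
      rw [norm_pow, ← mul_pow]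
      gcongr
      exact (fderiv ℝ f x).le_opNorm y
    simp only [g]
    rw [integral_sub i1 (integrable_const _), gam_sq]
    simp
  have hXYc : Continuous (fun z : ℝ × (Ed d × Ed d) => (X z.1 z.2, Y z.1 z.2)) := by
    simp only [X, Y]; fun_prop
  have hHi : Integrable (fun z : ℝ × (Ed d × Ed d) => g (X z.1 z.2, Y z.1 z.2)) (T.prod P) := by
    have hb2 : Integrable (fun z : ℝ × (Ed d × Ed d) => (C:ℝ)^2 * (‖z.2.1‖^2 + ‖z.2.2‖^2))
      (T.prod P) := hbi.comp_snd T
    refine hb2.mono' (hgm.comp hXYc.measurable).aestronglyMeasurable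
      (Eventually.of_forall fun z => (hgb _).trans (le_of_eq ?_))
    congr 1
    simp only [X, Y]
    rw [norm_add_sq_real, norm_add_sq_real]
    simp only [norm_smul, norm_neg, Real.norm_eq_abs, mul_pow, sq_abs, inner_smul_left, inner_smul_right,
      neg_smul, inner_neg_left]
    have := Real.sin_sq_add_cos_sq z.1
    simp only [conj_trivial]
    linear_combination (‖z.2.1‖^2 + ‖z.2.2‖^2) * this
  have hrot : ∀ θ, ∫ p, g (X θ p, Y θ p) ∂P = ∫ q, g q ∂P := by
    intro θ
    have := gam_rot d θ
    conv_rhs => rw [hP, ← this.map_eq]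
    rw [integral_map this.measurable.aemeasurable hgm.aestronglyMeasurable]
  have hswap : ∫ p, (∫ θ, g (X θ p, Y θ p) ∂T) ∂P =
      Real.pi * ∫ x, (‖fderiv ℝ f x‖ ^ 2 - f x ^ 2) ∂gam d := by
    rw [← integral_integral_swap (f := fun θ p => g (X θ p, Y θ p)) hHi]
    simp_rw [hrot, hintg]
    rw [integral_const]
    simp [hT, hpi.le, measureReal_def]
  -- a.e. differentiability
  have hdiff : ∀ᵐ p ∂P, ∀ᵐ θ ∂T, DifferentiableAt ℝ f (X θ p) := by
    have hms : MeasurableSet {z : ℝ × (Ed d × Ed d) | DifferentiableAt ℝ f (X z.1 z.2)} :=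
      (measurable_fst.comp hXYc.measurable) (measurableSet_of_differentiableAt ℝ f)
    refine (Measure.ae_ae_comm (p := fun θ p => DifferentiableAt ℝ f (X θ p)) hms).1 ?_
    refine Eventually.of_forall fun θ => ?_
    have r : ∀ᵐ x ∂gam d, DifferentiableAt ℝ f x := (gam_ac d).ae_le hf.ae_differentiableAt
    have r2 : ∀ᵐ q ∂P, DifferentiableAt ℝ f q.1 := Measure.quasiMeasurePreserving_fst.ae r
    exact (gam_rot d θ).quasiMeasurePreserving.ae r2
  have hLip : ∀ p, LipschitzWith (C * (‖p.1‖₊ + ‖p.2‖₊)) (fun θ => f (X θ p)) := by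
    intro p
    refine hf.comp (LipschitzWith.of_dist_le_mul fun a b => ?_)
    rw [dist_eq_norm]
    have e : X a p - X b p = (Real.cos a - Real.cos b) • p.1 + (Real.sin a - Real.sin b) • p.2 := by
      simp only [X, sub_smul]; abel
    rw [e]
    have c1 : |Real.cos a - Real.cos b| ≤ dist a b := by
      have := Real.lipschitzWith_cos.dist_le_mul a b
      simpa [Real.dist_eq] using this
    have c2 : |Real.sin a - Real.sin b| ≤ dist a b := by
      have := Real.lipschitzWith_sin.dist_le_mul a b
      simpa [Real.dist_eq] using this
    calc _ ≤ ‖(Real.cos a - Real.cos b) • p.1‖ + ‖(Real.sin a - Real.sin b) • p.2‖ := norm_add_le _ _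
      _ = |Real.cos a - Real.cos b| * ‖p.1‖ + |Real.sin a - Real.sin b| * ‖p.2‖ := by
        simp only [norm_smul, Real.norm_eq_abs]
      _ ≤ dist a b * ‖p.1‖ + dist a b * ‖p.2‖ := by gcongr
      _ = _ := by push_cast; ring
  have hap : ∀ p θ, f (X (θ + Real.pi) p) = - f (X θ p) := by
    intro p θ
    rw [← hodd]
    congr 1
    simp only [X, Real.cos_add_pi, Real.sin_add_pi, neg_smul, neg_add]
  have hPhi : ∀ᵐ p ∂P, (∫ θ, g (X θ p, Y θ p) ∂T) =
      ∫ θ in (0:ℝ)..Real.pi, (deriv (fun θ => f (X θ p)) θ ^ 2 - f (X θ p) ^ 2) := by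
    filter_upwards [hdiff] with p hp
    rw [intervalIntegral.integral_of_le hpi.le]
    apply integral_congr_ae
    filter_upwards [hp] with θ hθ
    have hx : HasDerivAt (fun θ => X θ p) (Y θ p) θ := by
      simp only [X, Y]
      exact ((Real.hasDerivAt_cos θ).smul_const p.1).add ((Real.hasDerivAt_sin θ).smul_const p.2)
    have := (hθ.hasFDerivAt.comp_hasDerivAt θ hx).deriv
    simp only [Function.comp_def] at this
    simp only [g]
    rw [this]
  have hnn : ∀ᵐ p ∂P, 0 ≤ ∫ θ, g (X θ p, Y θ p) ∂T := by
    filter_upwards [hPhi] with p hp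
    rw [hp]
    exact (wirtinger (hLip p) (hap p)).1
  constructor
  · have := integral_nonneg_of_ae hnn
    rw [hswap] at this
    exact nonneg_of_mul_nonneg_right this hpi
  · intro heq
    rw [heq, mul_zero] at hswap
    have hz := (integral_eq_zero_iff_of_nonneg_ae hnn (hHi.integral_prod_right)).1 hswap
    have hae : ∀ᵐ p ∂P, ∀ θ, f (X θ p) = f p.1 * Real.cos θ + f p.2 * Real.sin θ := by
      filter_upwards [hPhi, hz] with p hp hp2 θ
      rw [hp] at hp2
      have := (wirtinger (hLip p) (hap p)).2 hp2 θ
      simpa [X] using this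
    intro x y θ
    have e : (fun p : Ed d × Ed d => f (X θ p)) =
        fun p => f p.1 * Real.cos θ + f p.2 * Real.sin θ := by
      have hfc := hf.continuous
      have k1 : Continuous (fun p : Ed d × Ed d => f (X θ p)) := by
        simp only [X]; fun_prop
      have k2 : Continuous (fun p : Ed d × Ed d => f p.1 * Real.cos θ + f p.2 * Real.sin θ) := by
        fun_prop
      refine (k1.ae_eq_iff_eq P k2).1 ?_
      filter_upwards [hae] with p hp
      exact hp θ
    exact congrFun e (x, y)

end Poincare

section Support

variable {d : ℕ} {K : Set (Ed d)}

lemma supp_attain (hc : IsCompact K) (hn : K.Nonempty) (x : Ed d) :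
    ∃ k ∈ K, suppFn d K x = inner ℝ x k ∧ ∀ y ∈ K, (inner ℝ x y : ℝ) ≤ inner ℝ x k := by
  obtain ⟨k, hk, hm⟩ := hc.exists_isMaxOn hn (f := fun y => (inner ℝ x y : ℝ)) (by fun_prop)
  refine ⟨k, hk, ?_, fun y hy => hm hy⟩
  apply le_antisymm
  · apply csSup_le (hn.image _)
    rintro _ ⟨y, hy, rfl⟩
    exact hm hy
  · apply le_csSup
    · refine ⟨inner ℝ x k, ?_⟩
      rintro _ ⟨y, hy, rfl⟩
      exact hm hy
    · exact ⟨k, hk, rfl⟩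

lemma supp_le (hc : IsCompact K) (x : Ed d) {k : Ed d} (hk : k ∈ K) :
    (inner ℝ x k : ℝ) ≤ suppFn d K x := by
  obtain ⟨k', hk', h1, h2⟩ := supp_attain hc ⟨k, hk⟩ x
  rw [h1]; exact h2 k hk

lemma supp_lip (hc : IsCompact K) (hn : K.Nonempty) {R : NNReal} (hR : ∀ k ∈ K, ‖k‖ ≤ R) :
    LipschitzWith R (suppFn d K) := by
  apply LipschitzWith.of_le_add_mul
  intro x y
  obtain ⟨k, hk, h1, -⟩ := supp_attain hc hn x
  have h2 := supp_le hc y hk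
  have h3 : (inner ℝ (x - y) k : ℝ) ≤ ‖x - y‖ * ‖k‖ := real_inner_le_norm _ _
  rw [inner_sub_left] at h3
  have h4 : ‖x - y‖ * ‖k‖ ≤ R * dist x y := by
    rw [dist_eq_norm, mul_comm]; gcongr; exact hR k hk
  linarith

lemma supp_smul (hc : IsCompact K) (hn : K.Nonempty) {a : ℝ} (ha : 0 ≤ a) (x : Ed d) :
    suppFn d K (a • x) = a * suppFn d K x := by
  obtain ⟨k, hk, h1, h1'⟩ := supp_attain hc hn x
  obtain ⟨l, hl, h2, h2'⟩ := supp_attain hc hn (a • x)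
  have := h2' k hk
  have h3 := h1' l hl
  rw [h1, h2]
  simp only [inner_smul_left, conj_trivial] at *
  apply le_antisymm <;> nlinarith

lemma supp_zero (hc : IsCompact K) (hn : K.Nonempty) : suppFn d K 0 = 0 := by
  have := supp_smul hc hn le_rfl (0 : Ed d)
  simpa using this

/-- `G s x = max_k (s⟨x,k⟩ - s²‖k‖²/2)`. -/
def GG (d : ℕ) (K : Set (Ed d)) (s : ℝ) (x : Ed d) : ℝ := (‖x‖ ^ 2 - infDist x (s • K) ^ 2) / 2

lemma dist_smul_sq (s : ℝ) (x k : Ed d) : dist x (s • k) ^ 2 =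
    ‖x‖ ^ 2 - 2 * (s * inner ℝ x k) + s ^ 2 * ‖k‖ ^ 2 := by
  rw [dist_eq_norm, norm_sub_sq_real, inner_smul_right, norm_smul, mul_pow, Real.norm_eq_abs, sq_abs]

lemma GG_ge (s : ℝ) (x : Ed d) {k : Ed d} (hk : k ∈ K) :
    s * inner ℝ x k - s ^ 2 * ‖k‖ ^ 2 / 2 ≤ GG d K s x := by
  have h1 : infDist x (s • K) ≤ dist x (s • k) := infDist_le_dist_of_mem (Set.smul_mem_smul_set hk)
  have h2 : infDist x (s • K) ^ 2 ≤ dist x (s • k) ^ 2 := by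
    gcongr; exact infDist_nonneg
  rw [dist_smul_sq] at h2
  unfold GG; linarith

lemma GG_attain (hc : IsCompact K) (hn : K.Nonempty) (s : ℝ) (x : Ed d) :
    ∃ k ∈ K, GG d K s x = s * inner ℝ x k - s ^ 2 * ‖k‖ ^ 2 / 2 := by
  obtain ⟨y, hy, h⟩ := (hc.smul s).exists_infDist_eq_dist (hn.smul_set) x
  obtain ⟨k, hk, rfl⟩ := hy
  refine ⟨k, hk, ?_⟩
  unfold GG
  rw [h]
  simp only [dist_smul_sq]
  ring

lemma supp_grad (hc : IsCompact K) (hn : K.Nonempty) {x : Ed d}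
    (hx : DifferentiableAt ℝ (suppFn d K) x) :
    ∃ v ∈ K, suppFn d K x = inner ℝ x v ∧ fderiv ℝ (suppFn d K) x = innerSL ℝ v := by
  obtain ⟨v, hv, h1, -⟩ := supp_attain hc hn x
  refine ⟨v, hv, h1, ?_⟩
  have hd : HasFDerivAt (fun y => suppFn d K y - innerSL ℝ v y)
      (fderiv ℝ (suppFn d K) x - innerSL ℝ v) x :=
    hx.hasFDerivAt.sub (innerSL ℝ v).hasFDerivAt
  have hmin : IsLocalMin (fun y => suppFn d K y - innerSL ℝ v y) x := by
    refine Eventually.of_forall fun y => ?_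
    have := supp_le hc y hv
    simp only [innerSL_apply_apply]
    rw [real_inner_comm x v, real_inner_comm y v, h1]
    linarith
  exact sub_eq_zero.1 (hmin.hasFDerivAt_eq_zero hd)

/-- `q_s = (h - G_s/s)/s`. -/
lemma q_bounds (hc : IsCompact K) (hn : K.Nonempty) {R : ℝ} (hR : ∀ k ∈ K, ‖k‖ ≤ R)
    {s : ℝ} (hs : 0 < s) (x : Ed d) :
    0 ≤ (s * suppFn d K x - GG d K s x) / s ^ 2 ∧
      (s * suppFn d K x - GG d K s x) / s ^ 2 ≤ R ^ 2 / 2 := by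
  obtain ⟨k, hk, h1⟩ := GG_attain hc hn s x
  obtain ⟨l, hl, h2, h2'⟩ := supp_attain hc hn x
  have h3 := GG_ge s x hl
  constructor
  · apply div_nonneg _ (by positivity)
    rw [h1, h2]
    have := h2' k hk
    have : 0 ≤ s ^ 2 * ‖k‖^2 := by positivity
    nlinarith
  · rw [div_le_iff₀ (by positivity), h2]
    have : ‖l‖^2 ≤ R^2 := by gcongr; exact hR l hl
    nlinarith [sq_nonneg s]

lemma q_lim (hc : IsCompact K) (hn : K.Nonempty) {x : Ed d}
    (hx : DifferentiableAt ℝ (suppFn d K) x) :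
    Tendsto (fun s => (s * suppFn d K x - GG d K s x) / s ^ 2) (𝓝[>] 0)
      (𝓝 (‖fderiv ℝ (suppFn d K) x‖ ^ 2 / 2)) := by
  obtain ⟨v, hv, h1, h2⟩ := supp_grad hc hn hx
  have hline : HasDerivAt (fun s : ℝ => suppFn d K (x - s • v)) (-‖v‖^2) 0 := by
    have e1 : HasDerivAt (fun s : ℝ => x - s • v) (-v) 0 := by
      have := ((hasDerivAt_id (0:ℝ)).smul_const v).const_sub x
      simpa using this
    have e2 : HasFDerivAt (suppFn d K) (innerSL ℝ v) (x - (0:ℝ) • v) := by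
      rw [← h2]; simpa using hx.hasFDerivAt
    have := e2.comp_hasDerivAt (0:ℝ) e1
    simpa [Function.comp_def, real_inner_self_eq_norm_sq] using this
  have hslope := hline.tendsto_slope_zero_right
  simp only [zero_add, zero_smul, sub_zero, smul_eq_mul] at hslope
  have hlow : Tendsto (fun s => -(s⁻¹ * (suppFn d K (x - s • v) - suppFn d K x)) - ‖v‖^2/2) (𝓝[>] 0)
      (𝓝 (‖v‖^2/2)) := by
    have := hslope.neg.sub_const (‖v‖^2/2)
    convert this using 2; ring
  rw [h2, innerSL_apply_norm]
  refine tendsto_of_tendsto_of_tendsto_of_le_of_le' hlow tendsto_const_nhds ?_ ?_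
  · filter_upwards [self_mem_nhdsWithin] with s hs
    have hs : 0 < s := hs
    obtain ⟨k, hk, h3⟩ := GG_attain hc hn s x
    have h4 := supp_le hc (x - s • v) hk
    rw [inner_sub_left, inner_smul_left, conj_trivial] at h4
    have h5 : (inner ℝ v k : ℝ) ≤ ‖v‖^2/2 + ‖k‖^2/2 := by
      have := norm_sub_sq_real v k
      nlinarith [sq_nonneg (‖v - k‖)]
    rw [h3, le_div_iff₀ (by positivity)]
    have h6 : (-(s⁻¹ * (suppFn d K (x - s • v) - suppFn d K x)) - ‖v‖ ^ 2 / 2) * s ^ 2 =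
      s * (suppFn d K x - suppFn d K (x - s • v)) - s^2 * (‖v‖ ^ 2 / 2) := by field_simp; ring
    rw [h6]
    nlinarith [mul_le_mul_of_nonneg_left h4 hs.le, mul_le_mul_of_nonneg_left h5 (sq_nonneg s)]
  · filter_upwards [self_mem_nhdsWithin] with s hs
    have hs : 0 < s := hs
    have h3 := GG_ge s x hv
    rw [div_le_iff₀ (by positivity), h1]
    linarith

lemma GG_bound (hc : IsCompact K) (hn : K.Nonempty) {R : ℝ} (hR : ∀ k ∈ K, ‖k‖ ≤ R)
    {s : ℝ} (hs : 0 < s) (hs1 : s ≤ 1) (x : Ed d) :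
    |GG d K s x| ≤ s * (R * ‖x‖ + R ^ 2) := by
  obtain ⟨k, hk, h1⟩ := GG_attain hc hn s x
  have h2 := abs_real_inner_le_norm x k
  have h3 : ‖x‖ * ‖k‖ ≤ R * ‖x‖ := by rw [mul_comm]; gcongr; exact hR k hk
  have h4 : ‖k‖^2 ≤ R^2 := by gcongr; exact hR k hk
  have h5 := abs_le.1 (h2.trans h3)
  have h6 : s^2 * ‖k‖^2/2 ≤ s * R^2 := by
    have : s^2 * ‖k‖^2 ≤ s * R^2 := by
      have : s^2 ≤ s := by nlinarith
      gcongr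
    have : 0 ≤ s^2 * ‖k‖^2 := by positivity
    linarith
  have h7 : 0 ≤ s^2 * ‖k‖^2/2 := by positivity
  have h8 : 0 ≤ s * R^2 := by positivity
  rw [h1, abs_le]
  constructor <;> nlinarith [h5.1, h5.2]

lemma exp_taylor (G : ℝ) : |Real.exp G - 1 - G| ≤ G ^ 2 * Real.exp |G| ∧
    |Real.exp G - 1 - G - G ^ 2 / 2| ≤ |G| ^ 3 * Real.exp |G| := by
  have h2 := Complex.norm_exp_sub_sum_le_norm_mul_exp (G : ℂ) 2
  have h3 := Complex.norm_exp_sub_sum_le_norm_mul_exp (G : ℂ) 3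
  simp only [Finset.sum_range_succ, Finset.sum_range_zero] at h2 h3
  norm_num [Nat.factorial] at h2 h3
  constructor
  · have : (Complex.exp G - (1 + (G:ℂ))) = ((Real.exp G - 1 - G : ℝ) : ℂ) := by push_cast; ring
    rw [this, Complex.norm_real, Real.norm_eq_abs] at h2
    exact h2
  · have : (Complex.exp G - (1 + (G:ℂ) + G^2/2)) = ((Real.exp G - 1 - G - G^2/2 : ℝ) : ℂ) := by
      push_cast; ring
    rw [this, Complex.norm_real, Real.norm_eq_abs] at h3
    exact h3

lemma GG_cont (hs : True) (s : ℝ) : Continuous (GG d K s) := by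
  unfold GG
  have := continuous_infDist_pt (s • K)
  fun_prop

lemma expand (hc : IsCompact K) (hn : K.Nonempty) :
    Tendsto (fun s => ((∫ x, Real.exp (GG d K s x) ∂gam d) - 1 - s * ∫ x, suppFn d K x ∂gam d) / s ^ 2)
      (𝓝[>] 0) (𝓝 (∫ x, (suppFn d K x ^ 2 / 2 - ‖fderiv ℝ (suppFn d K) x‖ ^ 2 / 2) ∂gam d)) := by
  obtain ⟨R0, hR0⟩ := hc.isBounded.exists_norm_le
  set R : NNReal := Real.toNNReal R0 with hRdef
  have hR : ∀ k ∈ K, ‖k‖ ≤ (R:ℝ) := fun k hk => (hR0 k hk).trans (Real.le_coe_toNNReal R0)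
  have hlip := supp_lip hc hn hR
  have hz := supp_zero hc hn
  let b : Ed d → ℝ := fun x => R * ‖x‖ + (R:ℝ)^2
  have hb0 : ∀ x, 0 ≤ b x := fun x => by positivity
  have hhb : ∀ x, |suppFn d K x| ≤ b x := by
    intro x
    have := hlip.dist_le_mul x 0
    rw [hz, dist_zero_right, dist_zero_right, Real.norm_eq_abs] at this
    have h2 : (0:ℝ) ≤ (R:ℝ)^2 := by positivity
    simp only [b]; linarith
  have hbi : Integrable (fun x => 2 * (Real.exp (b x) * Real.exp (b x)) + (R:ℝ)^2/2) (gam d) := by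
    refine Integrable.add ?_ (integrable_const _)
    refine ((gam_exp d (2*R)).const_mul (2 * Real.exp (2 * (R:ℝ)^2))).congr
      (Eventually.of_forall fun x => ?_)
    simp only [b]
    rw [mul_assoc, ← Real.exp_add, ← Real.exp_add]; ring_nf
  have hexpi : ∀ s, 0 < s → s ≤ 1 → Integrable (fun x => Real.exp (GG d K s x)) (gam d) := by
    intro s hs hs1
    refine hbi.mono' (by have := GG_cont (K := K) trivial s; fun_prop) (Eventually.of_forall fun x => ?_)
    rw [Real.norm_eq_abs, Real.abs_exp]
    have h1 := GG_bound hc hn hR hs hs1 x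
    have h2 : GG d K s x ≤ b x := by
      have := (abs_le.1 h1).2
      have h3 : s * b x ≤ b x := by nlinarith [hb0 x]
      exact this.trans h3
    have h3 : 1 ≤ Real.exp (b x) := Real.one_le_exp (hb0 x)
    have h4 := Real.exp_le_exp.2 h2
    nlinarith [sq_nonneg (R:ℝ)]
  have hhi : Integrable (suppFn d K) (gam d) := by
    refine hbi.mono' hlip.continuous.aestronglyMeasurable (Eventually.of_forall fun x => ?_)
    rw [Real.norm_eq_abs]
    have h3 : 1 ≤ Real.exp (b x) := Real.one_le_exp (hb0 x)
    have h4 := Real.add_one_le_exp (b x)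
    nlinarith [sq_nonneg (R:ℝ), hhb x]
  have hrw : ∀ᶠ s in 𝓝[>] (0:ℝ), ∫ x, (Real.exp (GG d K s x) - 1 - s * suppFn d K x) / s ^ 2 ∂gam d =
      ((∫ x, Real.exp (GG d K s x) ∂gam d) - 1 - s * ∫ x, suppFn d K x ∂gam d) / s ^ 2 := by
    filter_upwards [Ioc_mem_nhdsGT (zero_lt_one' ℝ)] with s hs
    have i1 : Integrable (fun x => Real.exp (GG d K s x) - 1) (gam d) :=
      (hexpi s hs.1 hs.2).sub (integrable_const _)
    rw [integral_div, integral_sub i1 (hhi.const_mul s),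
      integral_sub (hexpi s hs.1 hs.2) (integrable_const _), integral_const_mul]
    simp
  refine Tendsto.congr' hrw ?_
  refine tendsto_integral_filter_of_dominated_convergence _ ?_ ?_ hbi ?_
  · refine Eventually.of_forall fun s => ?_
    have h1 := GG_cont (K := K) trivial s
    have h2 := hlip.continuous
    have : Continuous (fun x => (Real.exp (GG d K s x) - 1 - s * suppFn d K x) / s ^ 2) := by fun_prop
    exact this.aestronglyMeasurable
  · filter_upwards [Ioc_mem_nhdsGT (zero_lt_one' ℝ)] with s hs
    refine Eventually.of_forall fun x => ?_
    obtain ⟨hs0, hs1⟩ := hs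
    set G := GG d K s x with hG
    set h := suppFn d K x
    have h1 : |G| ≤ s * b x := GG_bound hc hn hR hs0 hs1 x
    obtain ⟨q1, q2⟩ := q_bounds hc hn hR hs0 x
    have e1 := (exp_taylor G).1
    have e2 : (Real.exp G - 1 - s * h) / s^2 = (Real.exp G - 1 - G) / s^2 - (s * h - G)/s^2 := by
      field_simp; ring
    rw [e2, Real.norm_eq_abs]
    have hGb : |G| ≤ b x := h1.trans (by nlinarith [hb0 x])
    have e3 : |(Real.exp G - 1 - G) / s^2| ≤ b x ^ 2 * Real.exp (b x) := by
      rw [abs_div, abs_of_pos (by positivity : 0 < s^2), div_le_iff₀ (by positivity)]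
      calc _ ≤ G^2 * Real.exp |G| := e1
        _ ≤ (s * b x)^2 * Real.exp (b x) := by
          rw [← sq_abs G]
          gcongr
        _ = _ := by ring
    have e4 : b x ^ 2 ≤ 2 * Real.exp (b x) := by
      have := Real.quadratic_le_exp_of_nonneg (hb0 x)
      nlinarith [hb0 x]
    have e5 : b x ^ 2 * Real.exp (b x) ≤ 2 * (Real.exp (b x) * Real.exp (b x)) := by
      nlinarith [Real.exp_pos (b x)]
    have e6 := abs_sub ((Real.exp G - 1 - G) / s^2) ((s * h - G)/s^2)
    rw [abs_of_nonneg q1] at e6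
    linarith
  · have r : ∀ᵐ x ∂gam d, DifferentiableAt ℝ (suppFn d K) x :=
      (gam_ac d).ae_le hlip.ae_differentiableAt
    filter_upwards [r] with x hx
    have hq := q_lim hc hn hx
    have hs0 : Tendsto (fun s : ℝ => s) (𝓝[>] 0) (𝓝 0) := nhdsWithin_le_nhds
    have hGs : Tendsto (fun s => GG d K s x / s) (𝓝[>] 0) (𝓝 (suppFn d K x)) := by
      have : Tendsto (fun s => suppFn d K x - s * ((s * suppFn d K x - GG d K s x) / s ^ 2)) (𝓝[>] 0)
        (𝓝 (suppFn d K x - 0 * (‖fderiv ℝ (suppFn d K) x‖ ^ 2 / 2))) := (hs0.mul hq).const_sub _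
      rw [zero_mul, sub_zero] at this
      refine this.congr' ?_
      filter_upwards [self_mem_nhdsWithin] with s hs
      have hs : 0 < s := hs
      field_simp; ring
    have hrem : Tendsto (fun s => (Real.exp (GG d K s x) - 1 - GG d K s x - GG d K s x ^ 2 / 2) / s^2)
        (𝓝[>] 0) (𝓝 0) := by
      have hub : Tendsto (fun s : ℝ => s * (b x ^ 3 * Real.exp (b x))) (𝓝[>] 0) (𝓝 0) := by
        have := hs0.mul_const (b x ^ 3 * Real.exp (b x))
        simpa using this
      refine squeeze_zero_norm' ?_ hub
      filter_upwards [Ioc_mem_nhdsGT (zero_lt_one' ℝ)] with s hs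
      obtain ⟨hs0, hs1⟩ := hs
      have h1 : |GG d K s x| ≤ s * b x := GG_bound hc hn hR hs0 hs1 x
      have hGb : |GG d K s x| ≤ b x := h1.trans (by nlinarith [hb0 x])
      rw [Real.norm_eq_abs, abs_div, abs_of_pos (by positivity : 0 < s^2), div_le_iff₀ (by positivity)]
      calc _ ≤ |GG d K s x|^3 * Real.exp |GG d K s x| := (exp_taylor _).2
        _ ≤ (s * b x)^3 * Real.exp (b x) := by gcongr
        _ = _ := by ring
    have := (hrem.add ((hGs.pow 2).div_const 2)).sub hq
    rw [zero_add] at this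
    refine this.congr' ?_
    filter_upwards [self_mem_nhdsWithin] with s hs
    have hs : 0 < s := hs
    field_simp; ring

end Support

section Steiner

variable {d : ℕ} {K : Set (Ed d)}

lemma steiner_scale {W : ℕ → ℝ} (hW : IsQuermass d K W) {s r : ℝ} (hs : 0 < s) (hr : 0 ≤ r) :
    (volume (s • K + r • unitBall d)).toReal =
      ∑ i ∈ Finset.range (d + 1), ((d.choose i : ℝ) * W i * s ^ (d - i)) * r ^ i := by
  have h1 : s • K + r • unitBall d = s • (K + (r / s) • unitBall d) := by
    rw [smul_add, smul_smul, mul_div_cancel₀ _ hs.ne']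
  have h2 := hW (r / s) (by positivity)
  rw [h1, Measure.addHaar_smul, ENNReal.toReal_mul, h2, Finset.mul_sum]
  rw [finrank_euclideanSpace_fin, abs_of_pos (by positivity), ENNReal.toReal_ofReal (by positivity)]
  refine Finset.sum_congr rfl fun i hi => ?_
  have hi' : i ≤ d := by simpa [Nat.lt_succ_iff] using hi
  have : s ^ d = s ^ (d - i) * s ^ i := by rw [← pow_add, Nat.sub_add_cancel hi']
  rw [this, div_pow]
  field_simp

lemma nbhd_eq {A : Set (Ed d)} (hc : IsCompact A) (hn : A.Nonempty) {r : ℝ} (hr : 0 ≤ r) :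
    A + r • unitBall d = {x | infDist x A ≤ r} := by
  have h1 : r • unitBall d = closedBall (0 : Ed d) r := by
    unfold unitBall
    rw [smul_unitClosedBall, Real.norm_of_nonneg hr]
  rw [h1, hc.add_closedBall_zero hr]
  ext x
  rw [mem_cthickening_iff, Set.mem_ofPred_eq, infDist, ENNReal.le_ofReal_iff_toReal_le (infEDist_ne_top hn) hr]

lemma tail_int {δ : ℝ} (hδ : 0 ≤ δ) :
    ∫⁻ r in Set.Ioi δ, ENNReal.ofReal (r * Real.exp (-(1/2) * r ^ 2)) =
      ENNReal.ofReal (Real.exp (-(1/2) * δ ^ 2)) := by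
  have hd : ∀ x ∈ Set.Ici δ, HasDerivAt (fun r => - Real.exp (-(1/2) * r ^ 2))
      (x * Real.exp (-(1/2) * x ^ 2)) x := by
    intro x _
    have h := (((hasDerivAt_id x).pow 2).const_mul (-(1/2 : ℝ))).exp.neg
    convert! h using 1
    simp; ring
  have hp : ∀ x ∈ Set.Ioi δ, 0 ≤ x * Real.exp (-(1/2) * x ^ 2) := by
    intro x hx
    have : 0 ≤ x := hδ.trans (le_of_lt hx)
    positivity
  have ht : Tendsto (fun r : ℝ => - Real.exp (-(1/2) * r ^ 2)) atTop (𝓝 0) := by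
    rw [← neg_zero]
    refine (Real.tendsto_exp_atBot.comp ?_).neg
    exact (tendsto_pow_atTop (α := ℝ) two_ne_zero).const_mul_atTop_of_neg (by norm_num)
  have hi := integral_Ioi_of_hasDerivAt_of_nonneg' hd hp ht
  rw [← ofReal_integral_eq_lintegral_ofReal (integrableOn_Ioi_deriv_of_nonneg' hd hp ht)
    ((ae_restrict_iff' measurableSet_Ioi).2 (Eventually.of_forall hp)), hi]
  simp

lemma layer {A : Set (Ed d)} (hc : IsCompact A) (hn : A.Nonempty) :
    ∫⁻ x, ENNReal.ofReal (Real.exp (-(1/2) * infDist x A ^ 2)) =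
      ∫⁻ r in Set.Ioi (0:ℝ), ENNReal.ofReal (r * Real.exp (-(1/2) * r ^ 2)) *
        volume (A + r • unitBall d) := by
  have hcont := continuous_infDist_pt A
  have hm : MeasurableSet {p : Ed d × ℝ | infDist p.1 A ≤ p.2} :=
    (isClosed_le (by fun_prop) (by fun_prop)).measurableSet
  have e1 : ∀ x, ENNReal.ofReal (Real.exp (-(1/2) * infDist x A ^ 2)) =
      ∫⁻ r in Set.Ioi (0:ℝ), {p : Ed d × ℝ | infDist p.1 A ≤ p.2}.indicator
        (fun p => ENNReal.ofReal (p.2 * Real.exp (-(1/2) * p.2 ^ 2))) (x, r) := by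
    intro x
    have h0 : 0 ≤ infDist x A := infDist_nonneg
    rw [← tail_int h0, ← lintegral_indicator measurableSet_Ioi, ← lintegral_indicator measurableSet_Ioi]
    have : ∀ᵐ r : ℝ, r ≠ infDist x A := by
      simp [ae_iff]
    refine lintegral_congr_ae ?_
    filter_upwards [this] with r hr
    simp only [Set.indicator, Set.mem_Ioi, Set.mem_ofPred_eq]
    by_cases h : infDist x A < r
    · simp [h, h.le, h0.trans_lt h]
    · have : ¬ infDist x A ≤ r := fun h' => h (lt_of_le_of_ne h' hr.symm)
      simp [h, this]
  simp_rw [e1]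
  rw [lintegral_lintegral_swap]
  · refine setLIntegral_congr_fun measurableSet_Ioi fun r hr => ?_
    have hr : 0 < r := hr
    rw [nbhd_eq hc hn hr.le]
    have : ∀ x : Ed d, {p : Ed d × ℝ | infDist p.1 A ≤ p.2}.indicator
        (fun p => ENNReal.ofReal (p.2 * Real.exp (-(1/2) * p.2 ^ 2))) (x, r) =
        {x | infDist x A ≤ r}.indicator (fun _ => ENNReal.ofReal (r * Real.exp (-(1/2) * r ^ 2))) x := by
      intro x; simp [Set.indicator]
    simp_rw [this]
    rw [lintegral_indicator_const]
    exact (isClosed_le (by fun_prop) (by fun_prop)).measurableSet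
  · refine Measurable.aemeasurable ?_
    refine Measurable.indicator ?_ hm
    fun_prop

def mm (i : ℕ) : ℝ := ∫ r in Set.Ioi (0:ℝ), r ^ i * (r * Real.exp (-(1/2) * r ^ 2))

lemma mm_int (i : ℕ) :
    IntegrableOn (fun r : ℝ => r ^ i * (r * Real.exp (-(1/2) * r ^ 2))) (Set.Ioi 0) := by
  have h := integrableOn_rpow_mul_exp_neg_mul_sq (b := 1/2) (by norm_num) (s := ((i + 1 : ℕ) : ℝ))
    (by have : (0:ℝ) ≤ ((i+1 : ℕ) : ℝ) := Nat.cast_nonneg _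
        linarith)
  refine h.congr_fun (fun r _ => ?_) measurableSet_Ioi
  simp only [Real.rpow_natCast]; ring

lemma mm_pos (i : ℕ) : 0 < mm i := by
  unfold mm
  rw [setIntegral_pos_iff_support_of_nonneg_ae]
  · have : (Function.support fun r : ℝ => r ^ i * (r * Real.exp (-(1/2) * r ^ 2))) ∩ Set.Ioi 0 = Set.Ioi 0 := by
      ext r
      simp only [Set.mem_inter_iff, Function.mem_support, Set.mem_Ioi, and_iff_right_iff_imp]
      intro hr; positivity
    rw [this]; simp
  · refine (ae_restrict_iff' measurableSet_Ioi).2 (Eventually.of_forall fun r hr => ?_)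
    have : 0 < r := hr
    simp only [Pi.zero_apply]; positivity
  · exact mm_int i

lemma wills (hc : IsCompact K) (hn : K.Nonempty) {W : ℕ → ℝ} (hW : IsQuermass d K W) {s : ℝ}
    (hs : 0 < s) : ∫ x, Real.exp (-(1/2) * infDist x (s • K) ^ 2) =
      ∑ i ∈ Finset.range (d + 1), ((d.choose i : ℝ) * W i * mm i) * s ^ (d - i) := by
  have hcont := continuous_infDist_pt (s • K)
  rw [integral_eq_lintegral_of_nonneg_ae (Eventually.of_forall fun x => (Real.exp_pos _).le)
    (by fun_prop : Continuous _).aestronglyMeasurable, layer (hc.smul s) hn.smul_set]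
  have e : ∀ r ∈ Set.Ioi (0:ℝ), ENNReal.ofReal (r * Real.exp (-(1/2) * r ^ 2)) *
        volume (s • K + r • unitBall d) = ENNReal.ofReal (
        ∑ i ∈ Finset.range (d + 1), ((d.choose i : ℝ) * W i * s ^ (d - i)) *
          (r ^ i * (r * Real.exp (-(1/2) * r ^ 2)))) := by
    intro r hr
    have hr : 0 < r := hr
    have hfin : volume (s • K + r • unitBall d) ≠ ⊤ := by
      refine (IsCompact.measure_lt_top ?_).ne
      exact (hc.smul s).add ((isCompact_closedBall _ _).smul r)
    rw [← ENNReal.ofReal_toReal hfin, ← ENNReal.ofReal_mul (by positivity), steiner_scale hW hs hr.le,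
      Finset.mul_sum]
    congr 1
    refine Finset.sum_congr rfl fun i _ => ?_
    ring
  rw [setLIntegral_congr_fun measurableSet_Ioi e, ← integral_eq_lintegral_of_nonneg_ae]
  · rw [integral_finsetSum]
    · refine Finset.sum_congr rfl fun i _ => ?_
      rw [integral_const_mul]; unfold mm; ring
    · intro i _; exact (mm_int i).const_mul _
  · refine (ae_restrict_iff' measurableSet_Ioi).2 (Eventually.of_forall fun r hr => ?_)
    have hr : 0 < r := hr
    have h1 : (0:ℝ) ≤ r * Real.exp (-(1/2) * r ^ 2) * (volume (s • K + r • unitBall d)).toReal := by positivity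
    rw [steiner_scale hW hs hr.le, Finset.mul_sum] at h1
    refine h1.trans_eq (Finset.sum_congr rfl fun i _ => ?_)
    ring
  · refine Continuous.aestronglyMeasurable ?_
    fun_prop

lemma wills_gam (s : ℝ) : ∫ x, Real.exp (GG d K s x) ∂gam d =
    gconst d * ∫ x, Real.exp (-(1/2) * infDist x (s • K) ^ 2) := by
  rw [gam_integral]
  congr 2
  funext x
  rw [← Real.exp_add]
  congr 1
  unfold GG; ring

lemma poly_coeff {p : Polynomial ℝ} {α β L : ℝ}
    (h : Tendsto (fun s => (p.eval s - α - s * β) / s ^ 2) (𝓝[>] 0) (𝓝 L)) : p.coeff 2 = L := by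
  set q : Polynomial ℝ := p.divX.divX with hq
  have hp : ∀ s, p.eval s = q.eval s * s ^ 2 + p.coeff 1 * s + p.coeff 0 := by
    intro s
    have h1 := congrArg (Polynomial.eval s) (Polynomial.divX_mul_X_add p)
    have h2 := congrArg (Polynomial.eval s) (Polynomial.divX_mul_X_add p.divX)
    simp [Polynomial.coeff_divX] at h1 h2
    rw [← h1, ← h2]; ring
  have hid : Tendsto (fun s : ℝ => s) (𝓝[>] 0) (𝓝 0) := tendsto_nhdsWithin_of_tendsto_nhds tendsto_id
  have hpos : ∀ᶠ s : ℝ in 𝓝[>] 0, 0 < s := self_mem_nhdsWithin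
  have hqc : Tendsto (fun s => q.eval s) (𝓝[>] 0) (𝓝 (p.coeff 2)) := by
    have := (q.continuous.tendsto 0).comp hid
    have e : q.eval 0 = p.coeff 2 := by
      rw [← Polynomial.coeff_zero_eq_eval_zero, hq, Polynomial.coeff_divX, Polynomial.coeff_divX]
    rwa [e] at this
  have hpc : Tendsto (fun s => p.eval s) (𝓝[>] 0) (𝓝 (p.coeff 0)) := by
    have := (p.continuous.tendsto 0).comp hid
    rwa [← Polynomial.coeff_zero_eq_eval_zero] at this
  have h0 : p.coeff 0 = α := by
    have t1 := (h.mul (hid.pow 2))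
    have t2 : Tendsto (fun s => p.eval s - α - s * β) (𝓝[>] 0) (𝓝 (p.coeff 0 - α - 0 * β)) :=
      (hpc.sub_const _).sub (hid.mul_const β)
    have t3 := t1.congr' (f₂ := fun s => p.eval s - α - s * β) (by
      filter_upwards [hpos] with s hs
      field_simp)
    have := tendsto_nhds_unique t2 t3
    simp at this; linarith
  have h1 : p.coeff 1 = β := by
    have t1 := h.mul hid
    have t2 : Tendsto (fun s => q.eval s * s + p.coeff 1 - β) (𝓝[>] 0) (𝓝 (p.coeff 2 * 0 + p.coeff 1 - β)) :=
      ((hqc.mul hid).add_const _).sub_const _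
    have t3 := t1.congr' (f₂ := fun s => q.eval s * s + p.coeff 1 - β) (by
      filter_upwards [hpos] with s hs
      rw [hp, h0]
      field_simp
      ring)
    have := tendsto_nhds_unique t2 t3
    simp at this; linarith
  refine tendsto_nhds_unique hqc (h.congr' ?_)
  filter_upwards [hpos] with s hs
  rw [hp, h0, h1]
  field_simp
  ring

lemma quermass_formula (hd : 2 ≤ d) (hc : IsCompact K) (hn : K.Nonempty) {W : ℕ → ℝ}
    (hW : IsQuermass d K W) :
    (gconst d * (d.choose (d - 2)) * mm (d - 2)) * W (d - 2) =
    ∫ x, (suppFn d K x ^ 2 / 2 - ‖fderiv ℝ (suppFn d K) x‖ ^ 2 / 2) ∂gam d := by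
  set p : Polynomial ℝ := ∑ i ∈ Finset.range (d + 1),
    Polynomial.monomial (d - i) (gconst d * ((d.choose i : ℝ) * W i * mm i)) with hp
  have hE := expand hc hn
  have hev : ∀ s, 0 < s → p.eval s = ∫ x, Real.exp (GG d K s x) ∂gam d := by
    intro s hs
    rw [wills_gam, wills hc hn hW hs, hp, Polynomial.eval_finsetSum, Finset.mul_sum]
    refine Finset.sum_congr rfl fun i _ => ?_
    simp; ring
  have := poly_coeff (p := p) (α := 1) (β := ∫ x, suppFn d K x ∂gam d) (hE.congr' (by
    have hpos : ∀ᶠ s : ℝ in 𝓝[>] 0, 0 < s := self_mem_nhdsWithin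
    filter_upwards [hpos] with s hs
    rw [hev s hs]))
  rw [← this, hp, Polynomial.finsetSum_coeff, Finset.sum_eq_single (d - 2)]
  · rw [Polynomial.coeff_monomial, if_pos (by omega)]; ring
  · intro i hi hne
    rw [Polynomial.coeff_monomial, if_neg]
    simp at hi; omega
  · intro h; simp at h

end Steiner

section Final

variable {d : ℕ} {K : Set (Ed d)}

lemma supp_eq_of {A : Set (Ed d)} {x : Ed d} {c : ℝ} (h1 : ∃ k ∈ A, (inner ℝ x k : ℝ) = c)
    (h2 : ∀ k ∈ A, (inner ℝ x k : ℝ) ≤ c) : suppFn d A x = c := by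
  unfold suppFn
  refine IsGreatest.csSup_eq ⟨?_, ?_⟩
  · obtain ⟨k, hk, h⟩ := h1; exact ⟨k, hk, h⟩
  · rintro _ ⟨k, hk, rfl⟩; exact h2 k hk

lemma supp_neg (hc : IsCompact K) (hn : K.Nonempty) (x : Ed d) :
    suppFn d (-K) x = suppFn d K (-x) := by
  obtain ⟨k, hk, h1, h2⟩ := supp_attain hc hn (-x)
  refine supp_eq_of ⟨-k, by simpa using hk, by rw [h1]; simp⟩ ?_
  intro y hy
  have := supp_le hc (-x) (show -y ∈ K from hy)
  simpa using this

lemma supp_diff (hc : IsCompact K) (hn : K.Nonempty) (x : Ed d) :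
    suppFn d ((2⁻¹ : ℝ) • (K + -K)) x = (suppFn d K x + suppFn d K (-x)) / 2 := by
  obtain ⟨k, hk, h1, -⟩ := supp_attain hc hn x
  obtain ⟨l, hl, h2, -⟩ := supp_attain hc hn (-x)
  refine supp_eq_of ⟨(2⁻¹ : ℝ) • (k + -l),
    Set.smul_mem_smul_set (Set.add_mem_add hk (by simpa using hl)), ?_⟩ ?_
  · rw [h1, h2, inner_smul_right, inner_add_right, inner_neg_right, inner_neg_left]; ring
  · rintro _ ⟨_, ⟨y, hy, z, hz, rfl⟩, rfl⟩
    have a1 := supp_le hc x hy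
    have a2 := supp_le hc (-x) (show -z ∈ K from hz)
    simp only [inner_smul_right, inner_add_right]
    rw [inner_neg_neg] at a2
    linarith

lemma supp_trans (hc : IsCompact K) (hn : K.Nonempty) (v x : Ed d) :
    suppFn d ((fun y => y + v) '' K) x = suppFn d K x + inner ℝ x v := by
  obtain ⟨k, hk, h1, h2⟩ := supp_attain hc hn x
  refine supp_eq_of ⟨k + v, ⟨k, hk, rfl⟩, by rw [h1, inner_add_right]⟩ ?_
  rintro _ ⟨y, hy, rfl⟩
  have := supp_le hc x hy
  simp only [inner_add_right]; linarith

lemma supp_subset {A B : Set (Ed d)} (hA : IsCompact A) (hB : IsCompact B) (hBn : B.Nonempty)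
    (hBc : Convex ℝ B) (h : ∀ x, suppFn d A x ≤ suppFn d B x) : A ⊆ B := by
  intro a ha
  by_contra hab
  obtain ⟨f, u, h1, h2⟩ := geometric_hahn_banach_closed_point hBc hB.isClosed hab
  set x := (InnerProductSpace.toDual ℝ (Ed d)).symm f with hx
  have hf : ∀ y, f y = inner ℝ x y := fun y => (InnerProductSpace.toDual_symm_apply).symm
  obtain ⟨b, hb, e1, -⟩ := supp_attain hB hBn x
  have := supp_le hA x ha
  have := h x
  have := h1 b hb
  rw [hf] at h2 this
  linarith

def oddp (d : ℕ) (K : Set (Ed d)) (x : Ed d) : ℝ := (suppFn d K x - suppFn d K (-x)) / 2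

lemma oddp_lip (hc : IsCompact K) (hn : K.Nonempty) : ∃ C : NNReal, LipschitzWith C (oddp d K) ∧
    LipschitzWith C (suppFn d K) := by
  obtain ⟨R0, hR0⟩ := hc.isBounded.exists_norm_le
  have hl : LipschitzWith (Real.toNNReal R0) (suppFn d K) :=
    supp_lip hc hn fun k hk => (hR0 k hk).trans (Real.le_coe_toNNReal _)
  refine ⟨Real.toNNReal R0, ?_, hl⟩
  refine LipschitzWith.of_dist_le_mul fun x y => ?_
  have a1 := hl.dist_le_mul x y
  have a2 := hl.dist_le_mul (-x) (-y)
  rw [dist_neg_neg] at a2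
  rw [Real.dist_eq] at *
  unfold oddp
  rw [abs_le] at *
  constructor <;> linarith [a1.1, a1.2, a2.1, a2.2]

lemma L_diff (hc : IsCompact K) (hn : K.Nonempty) :
    ∫ x, (suppFn d ((2⁻¹ : ℝ) • (K + -K)) x ^ 2 / 2 -
      ‖fderiv ℝ (suppFn d ((2⁻¹ : ℝ) • (K + -K))) x‖ ^ 2 / 2) ∂gam d =
    (∫ x, (suppFn d K x ^ 2 / 2 - ‖fderiv ℝ (suppFn d K) x‖ ^ 2 / 2) ∂gam d) +
    2⁻¹ * ∫ x, (‖fderiv ℝ (oddp d K) x‖ ^ 2 - oddp d K x ^ 2) ∂gam d := by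
  obtain ⟨C, hol, hl⟩ := oddp_lip hc hn
  have hfun : suppFn d ((2⁻¹ : ℝ) • (K + -K)) =
      fun x => (suppFn d K x + suppFn d K (-x)) / 2 := funext (supp_diff hc hn)
  rw [hfun]
  set Φ : Ed d → ℝ := fun x => suppFn d K x ^ 2 / 2 - ‖fderiv ℝ (suppFn d K) x‖ ^ 2 / 2 with hΦ
  have hΦi : Integrable Φ (gam d) :=
    ((lip_sq_int hl (supp_zero hc hn)).div_const 2).sub ((lip_fderiv_sq_int hl).div_const 2)
  have hemb : MeasurableEmbedding (fun x : Ed d => -x) := (Homeomorph.neg (Ed d)).measurableEmbedding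
  have hneg : ∫ x, Φ (-x) ∂gam d = ∫ x, Φ x ∂gam d := (gam_neg d).integral_comp hemb Φ
  have hΦni : Integrable (fun x => Φ (-x)) (gam d) := ((gam_neg d).integrable_comp_emb hemb).2 hΦi
  have hfi : Integrable (fun x => ‖fderiv ℝ (oddp d K) x‖ ^ 2 - oddp d K x ^ 2) (gam d) :=
    (lip_fderiv_sq_int hol).sub (lip_sq_int hol (by simp [oddp]))
  have hd1 : ∀ᵐ x ∂gam d, DifferentiableAt ℝ (suppFn d K) x :=
    (gam_ac d).ae_le hl.ae_differentiableAt
  have hd2 : ∀ᵐ x ∂gam d, DifferentiableAt ℝ (suppFn d K) (-x) :=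
    (gam_neg d).quasiMeasurePreserving.ae hd1
  have key : ∀ᵐ x ∂gam d, ((suppFn d K x + suppFn d K (-x)) / 2) ^ 2 / 2 -
      ‖fderiv ℝ (fun x => (suppFn d K x + suppFn d K (-x)) / 2) x‖ ^ 2 / 2 =
      2⁻¹ * Φ x + 2⁻¹ * Φ (-x) + 2⁻¹ * (‖fderiv ℝ (oddp d K) x‖ ^ 2 - oddp d K x ^ 2) := by
    filter_upwards [hd1, hd2] with x hx1 hx2
    obtain ⟨v, -, -, hv⟩ := supp_grad hc hn hx1
    obtain ⟨w, -, -, hw⟩ := supp_grad hc hn hx2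
    have D1 : HasFDerivAt (suppFn d K) (innerSL ℝ v) x := hv ▸ hx1.hasFDerivAt
    have D2' : HasFDerivAt (suppFn d K) (innerSL ℝ w) (-x) := hw ▸ hx2.hasFDerivAt
    have D2 : HasFDerivAt (fun y => suppFn d K (-y)) (innerSL ℝ (-w)) x := by
      have := D2'.comp x (hasFDerivAt_id x).neg
      convert! this using 1
      ext y; simp
    have D3 : HasFDerivAt (fun x => (suppFn d K x + suppFn d K (-x)) / 2)
        (innerSL ℝ ((2⁻¹ : ℝ) • (v - w))) x := by
      have := (D1.add D2).const_mul (2⁻¹ : ℝ)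
      convert! this using 1
      · ext y; simp; ring
      · ext y; simp [sub_eq_add_neg]
    have D4 : HasFDerivAt (oddp d K) (innerSL ℝ ((2⁻¹ : ℝ) • (v + w))) x := by
      have := (D1.sub D2).const_mul (2⁻¹ : ℝ)
      convert! this using 1
      · ext y; simp [oddp]; ring
      · ext y; simp
    rw [D3.fderiv, D4.fderiv]
    simp only [hΦ, hv, hw, innerSL_apply_norm, norm_smul, mul_pow, oddp]
    have hp := parallelogram_law_with_norm ℝ v w
    norm_num
    nlinarith [hp]
  rw [integral_congr_ae key, integral_add, integral_add, integral_const_mul, integral_const_mul,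
    integral_const_mul, hneg]
  · ring
  · exact hΦi.const_mul _
  · exact hΦni.const_mul _
  · exact (hΦi.const_mul _).add (hΦni.const_mul _)
  · exact hfi.const_mul _

lemma oddp_linear (hc : IsCompact K) (hn : K.Nonempty)
    (h : ∀ x y : Ed d, ∀ θ : ℝ, oddp d K (Real.cos θ • x + Real.sin θ • y) =
      oddp d K x * Real.cos θ + oddp d K y * Real.sin θ) :
    ∃ v : Ed d, ∀ x, oddp d K x = inner ℝ x v := by
  obtain ⟨C, hol, hl⟩ := oddp_lip hc hn
  have hadd : ∀ x y, oddp d K (x + y) = oddp d K x + oddp d K y := by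
    intro x y
    have h1 := h x y (Real.pi / 4)
    rw [Real.cos_pi_div_four, Real.sin_pi_div_four, ← smul_add] at h1
    have hp : 0 < √2 / 2 := by positivity
    have h2 : oddp d K ((√2 / 2) • (x + y)) = (√2 / 2) * oddp d K (x + y) := by
      unfold oddp
      rw [← smul_neg, supp_smul hc hn hp.le, supp_smul hc hn hp.le]; ring
    rw [h2] at h1
    have := mul_left_cancel₀ hp.ne' (h1.trans (by ring :
      _ = (√2 / 2) * (oddp d K x + oddp d K y)))
    exact this
  let F : Ed d →+ ℝ := AddMonoidHom.mk' (oddp d K) hadd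
  let L : Ed d →L[ℝ] ℝ := F.toRealLinearMap hol.continuous
  refine ⟨(InnerProductSpace.toDual ℝ (Ed d)).symm L, fun x => ?_⟩
  rw [real_inner_comm, InnerProductSpace.toDual_symm_apply]
  rfl

lemma symm_iff (hcv : Convex ℝ K) (hc : IsCompact K) (hn : K.Nonempty) :
    (∃ v : Ed d, ∀ x, oddp d K x = inner ℝ x v) ↔ IsCentSymm d K := by
  constructor
  · rintro ⟨v, hv⟩
    refine ⟨(-2 : ℝ) • v, ?_⟩
    have hT : ∀ x, suppFn d ((fun y => y + (-2 : ℝ) • v) '' K) x = suppFn d (-K) x := by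
      intro x
      rw [supp_trans hc hn, supp_neg hc hn, inner_smul_right, ← hv]
      unfold oddp; ring
    have c1 : IsCompact ((fun y => y + (-2 : ℝ) • v) '' K) := hc.image (by fun_prop)
    have v1 : Convex ℝ ((fun y => y + (-2 : ℝ) • v) '' K) := by
      have := hcv.translate ((-2 : ℝ) • v)
      simpa [add_comm] using this
    exact Set.Subset.antisymm
      (supp_subset c1 hc.neg (by simpa using hn) hcv.neg fun x => (hT x).le)
      (supp_subset hc.neg c1 (hn.image _) v1 fun x => (hT x).ge)
  · rintro ⟨v, hv⟩
    refine ⟨(-2⁻¹ : ℝ) • v, fun x => ?_⟩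
    have h1 := supp_trans hc hn v x
    rw [hv, supp_neg hc hn] at h1
    unfold oddp
    rw [h1, inner_smul_right]; ring

lemma linear_zero {v : Ed d} (h : ∀ x, oddp d K x = inner ℝ x v) :
    ∫ x, (‖fderiv ℝ (oddp d K) x‖ ^ 2 - oddp d K x ^ 2) ∂gam d = 0 := by
  have e : oddp d K = fun x => innerSL ℝ v x := by
    funext x; rw [h, real_inner_comm]; rfl
  have hl : LipschitzWith ‖innerSL ℝ v‖₊ (fun x => innerSL ℝ v x) := (innerSL ℝ v).lipschitz
  have hder : ∀ x, fderiv ℝ (fun x => innerSL ℝ v x) x = innerSL ℝ v := fun x =>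
    (innerSL ℝ v).fderiv
  rw [e]
  simp only [hder]
  rw [integral_sub (integrable_const _) (lip_sq_int hl (by simp)), gam_sq]
  simp

end Final

/-- `W_{d-2}(DK) ≥ W_{d-2}(K)` for the difference body `DK = (1/2)(K + (−K))`, with equality
iff `K` is centrally symmetric. -/
theorem quermass_difference_body (d : ℕ) (hd : 3 ≤ d) (K : Set (Ed d))
    (hK : IsConvexBody d K) :
    ∀ W W' : ℕ → ℝ, IsQuermass d K W →
      IsQuermass d ((2⁻¹ : ℝ) • (K + -K)) W' →
      W (d - 2) ≤ W' (d - 2) ∧ (W' (d - 2) = W (d - 2) ↔ IsCentSymm d K) := by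
  intro W W' hW hW'
  obtain ⟨hcv, hc, hi⟩ := hK
  have hn : K.Nonempty := hi.mono interior_subset
  have hDc : IsCompact ((2⁻¹ : ℝ) • (K + -K)) := (hc.add hc.neg).smul _
  have hDn : ((2⁻¹ : ℝ) • (K + -K)).Nonempty := (hn.add (by simpa using hn)).smul_set
  have f1 := quermass_formula (by omega) hc hn hW
  have f2 := quermass_formula (by omega) hDc hDn hW'
  rw [L_diff hc hn, ← f1] at f2
  obtain ⟨C, hol, -⟩ := oddp_lip hc hn
  have hP := poincare hol (fun x => by unfold oddp; rw [neg_neg]; ring)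
  set c : ℝ := gconst d * (d.choose (d - 2)) * mm (d - 2) with hcdef
  have hcp : 0 < c := by
    have h1 := gconst_pos d
    have h2 := mm_pos (d - 2)
    have h3 : (0 : ℝ) < d.choose (d - 2) := by exact_mod_cast Nat.choose_pos (by omega)
    positivity
  set I := ∫ x, (‖fderiv ℝ (oddp d K) x‖ ^ 2 - oddp d K x ^ 2) ∂gam d with hI
  refine ⟨?_, ?_, ?_⟩
  · refine le_of_mul_le_mul_left ?_ hcp
    linarith [hP.1]
  · intro h
    rw [h] at f2
    exact (symm_iff hcv hc hn).1 (oddp_linear hc hn (hP.2 (by linarith)))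
  · intro h
    obtain ⟨v, hv⟩ := (symm_iff hcv hc hn).2 h
    have : I = 0 := linear_zero hv
    rw [this] at f2
    exact mul_left_cancel₀ hcp.ne' (by linarith)

end
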